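/- arXiv:2501.11316 — 2 statements merged into one kernel-verified Lean document; each statement's English description precedes it below -/
import Mathlib

section
/- Let 𝔟 ∈ {0,1} and let q ≥ 2 be an integer. For X > 1 define S_𝔟(X) = Σ_{χ ≠ χ0, χ(−1)=1} f_χ^{−𝔟} Σ_{m,n ≥ 1} μ(m)μ(n)χ(m)·conj(χ)(n)/(mn) · e^{−mn/X}. Then S_𝔟(X) = (ζ(2)/(2ζ(4))) · ∏_{p | q} (1 + p^{−2})^{−1} · Σ_{d | q, d > 1} φ*(d)/d^𝔟 + O( X^{−1/2} · Σ_{d | q, d > 1} d^{−𝔟} Σ_{l | d} φ(l) ) + O( (log X)^2 · Σ_{d | q, d > 1} d^{−𝔟} Σ_{l | d} φ(l)/l ), with absolute implied constants, where φ*(n) denotes the number of primitive Dirichlet characters modulo n. -/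
open Complex DirichletCharacter ArithmeticFunction

/-- `φ*(n)`, the number of primitive Dirichlet characters modulo `n`. -/
noncomputable def primitiveCharCount (n : ℕ) : ℕ :=
  Nat.card {χ : DirichletCharacter ℂ n // χ.IsPrimitive}

open scoped Classical in
/-- Sum over characters of conductor exactly `d`. -/
noncomputable def condSum (q : ℕ) [NeZero q] (d : ℕ) (m n : ℤ) : ℂ :=
  ∑ χ : DirichletCharacter ℂ q,
    if χ.conductor = d then χ (m : ZMod q) * (starRingEnd ℂ) (χ (n : ZMod q)) else 0

lemma conj_char_eq_inv {q : ℕ} [NeZero q] (χ : DirichletCharacter ℂ q) {n : ZMod q}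
    (hn : IsUnit n) : (starRingEnd ℂ) (χ n) = χ n⁻¹ := by
  have h1 : ‖χ n‖ = 1 := by
    obtain ⟨u, rfl⟩ := hn
    exact DirichletCharacter.unit_norm_eq_one χ u
  have h2 : χ n * χ n⁻¹ = 1 := by
    rw [← map_mul, ZMod.mul_inv_of_unit n hn, map_one]
  rw [← Complex.inv_eq_conj h1]
  exact inv_eq_of_mul_eq_one_right h2

lemma isUnit_of_isCoprime {q : ℕ} {n : ℤ} (h : IsCoprime n (q : ℤ)) : IsUnit (n : ZMod q) := by
  rw [← ZMod.coe_unitOfIsCoprime _ h]; exact Units.isUnit _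

lemma sum_char_conj {l : ℕ} [NeZero l] {n : ℤ} (m : ℤ) (hn : IsCoprime n (l : ℤ)) :
    ∑ ψ : DirichletCharacter ℂ l, ψ (m : ZMod l) * (starRingEnd ℂ) (ψ (n : ZMod l)) =
      if (m : ZMod l) = n then (l.totient : ℂ) else 0 := by
  have hu := isUnit_of_isCoprime hn
  have := DirichletCharacter.sum_char_inv_mul_char_eq ℂ hu (m : ZMod l)
  simp only [conj_char_eq_inv _ hu]
  simp only [mul_comm] at this ⊢
  rw [this]
  simp only [eq_comm]

lemma sum_condSum {q : ℕ} [NeZero q] {l : ℕ} (hl : l ∣ q) {m n : ℤ}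
    (hm : IsCoprime m (q : ℤ)) (hn : IsCoprime n (q : ℤ)) :
    ∑ d ∈ l.divisors, condSum q d m n =
      if (m : ZMod l) = n then (l.totient : ℂ) else 0 := by
  classical
  have hl0 : l ≠ 0 := fun h => NeZero.ne q (by subst h; simpa using hl)
  have : NeZero l := ⟨hl0⟩
  have hnl : IsCoprime n (l : ℤ) := hn.of_isCoprime_of_dvd_right (by exact_mod_cast hl)
  rw [← sum_char_conj m hnl]
  unfold condSum
  rw [Finset.sum_comm]
  have h1 : ∀ χ : DirichletCharacter ℂ q, (∑ d ∈ l.divisors, if χ.conductor = d then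
      χ (m : ZMod q) * (starRingEnd ℂ) (χ (n : ZMod q)) else 0) =
      if χ.conductor ∣ l then χ (m : ZMod q) * (starRingEnd ℂ) (χ (n : ZMod q)) else 0 := by
    intro χ
    rw [Finset.sum_ite_eq]
    simp [hl0]
  simp only [h1]
  rw [← Finset.sum_filter]
  symm
  refine Finset.sum_bij (fun ψ _ => changeLevel hl ψ) ?_ ?_ ?_ ?_
  · intro ψ _
    simp only [Finset.mem_filter, Finset.mem_univ, true_and]
    exact (mem_conductorSet_iff_conductor_dvd _ hl).mp (changeLevel_factorsThrough ψ hl)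
  · intro a _ b _ h
    exact changeLevel_injective hl h
  · intro χ hχ
    simp only [Finset.mem_filter, Finset.mem_univ, true_and] at hχ
    have h : χ.FactorsThrough l := (mem_conductorSet_iff_conductor_dvd _ hl).mpr hχ
    exact ⟨h.χ₀, Finset.mem_univ _, h.eq_changeLevel.symm⟩
  · intro ψ _
    rw [changeLevel_eq_cast_of_dvd' _ hl hm, changeLevel_eq_cast_of_dvd' _ hl hn]

lemma norm_condSum_le {q : ℕ} [NeZero q] {d : ℕ} (hd : d ∣ q) {m n : ℤ}
    (hm : IsCoprime m (q : ℤ)) (hn : IsCoprime n (q : ℤ)) :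
    ‖condSum q d m n‖ ≤ ∑ l ∈ d.divisors, if (m : ZMod l) = n then (l.totient : ℝ) else 0 := by
  have hd0 : 0 < d := Nat.pos_of_ne_zero fun h => NeZero.ne q (by subst h; simpa using hd)
  have key := (sum_eq_iff_sum_mul_moebius_eq_on (R := ℂ) (f := fun d => condSum q d m n)
    (g := fun l => if (m : ZMod l) = n then (l.totient : ℂ) else 0) {l | l ∣ q}
    (fun a b hab hb => hab.trans hb)).mp (fun l _ hl => sum_condSum hl hm hn) d hd0 hd
  rw [← key, ← Nat.sum_divisorsAntidiagonal' (f := fun _ l => if (m : ZMod l) = n then (l.totient : ℝ) else 0)]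
  refine norm_sum_le_of_le _ fun x _ => ?_
  rw [norm_mul]
  have h1 : ‖((moebius x.1 : ℤ) : ℂ)‖ ≤ 1 := by
    rw [Complex.norm_intCast]
    exact_mod_cast abs_moebius_le_one
  have h2 : ‖(if (m : ZMod x.2) = n then (x.2.totient : ℂ) else 0)‖ =
      if (m : ZMod x.2) = n then (x.2.totient : ℝ) else 0 := by
    split_ifs <;> simp
  rw [h2]
  refine mul_le_of_le_one_left ?_ h1
  split_ifs <;> positivity

lemma condSum_self {q : ℕ} [NeZero q] {d : ℕ} (hd : d ∣ q) {n : ℤ}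
    (hn : IsCoprime n (q : ℤ)) : condSum q d n n = primitiveCharCount d := by
  classical
  unfold condSum primitiveCharCount
  have hu := isUnit_of_isCoprime hn
  have h1 : ∀ χ : DirichletCharacter ℂ q,
      χ (n : ZMod q) * (starRingEnd ℂ) (χ (n : ZMod q)) = 1 := by
    intro χ
    rw [conj_char_eq_inv _ hu, ← map_mul, ZMod.mul_inv_of_unit _ hu, map_one]
  simp only [h1]
  rw [Finset.sum_boole]
  have : NeZero d := ⟨fun h => NeZero.ne q (by subst h; simpa using hd)⟩
  rw [Nat.card_eq_fintype_card, Fintype.card_subtype]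
  congr 1
  symm
  refine Finset.card_bij (fun ψ _ => changeLevel hd ψ) ?_ ?_ ?_
  · intro ψ h
    simp only [Finset.mem_filter, Finset.mem_univ, true_and] at h ⊢
    rw [conductor_changeLevel]; exact h
  · intro a _ b _ h
    exact changeLevel_injective hd h
  · intro χ hχ
    simp only [Finset.mem_filter, Finset.mem_univ, true_and] at hχ
    have h : χ.FactorsThrough d := (mem_conductorSet_iff_conductor_dvd _ hd).mpr hχ.dvd
    refine ⟨h.χ₀, ?_, h.eq_changeLevel.symm⟩
    simp only [Finset.mem_filter, Finset.mem_univ, true_and]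
    have := conductor_changeLevel h.χ₀ hd
    rw [← h.eq_changeLevel, hχ] at this
    exact this.symm

lemma primitiveCharCount_le (d : ℕ) (hd : 0 < d) :
    (primitiveCharCount d : ℝ) ≤ ∑ l ∈ d.divisors, (l.totient : ℝ) := by
  have : NeZero d := ⟨hd.ne'⟩
  have h1 : primitiveCharCount d ≤ d.totient := by
    rw [← DirichletCharacter.card_eq_totient_of_hasEnoughRootsOfUnity ℂ d]
    exact Nat.card_le_card_of_injective _ Subtype.val_injective
  calc (primitiveCharCount d : ℝ) ≤ d.totient := by exact_mod_cast h1
    _ ≤ _ := Finset.single_le_sum (f := fun l : ℕ => (l.totient : ℝ)) (fun _ _ => by positivity)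
        (by simp [hd.ne'])

lemma pseries_summable {s : ℝ} (hs : 0 < s) : Summable (fun n : ℕ => 1 / (n : ℝ) ^ (1 + s)) :=
  Real.summable_one_div_nat_rpow.mpr (by linarith)

lemma pseries_le {s : ℝ} (hs : 0 < s) : ∑' n : ℕ, 1 / (n : ℝ) ^ (1 + s) ≤ 1 + 1 / s := by
  rw [(pseries_summable hs).tsum_eq_zero_add]
  have h := ZetaAsymptotics.zeta_limit_aux1 (s := 1 + s) (by linarith)
  have h2 : 0 ≤ ZetaAsymptotics.termTSum (1 + s) :=
    tsum_nonneg fun n => ZetaAsymptotics.term_nonneg (n + 1) _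
  have h3 : 0 ≤ (1 + s) * ZetaAsymptotics.termTSum (1 + s) := by positivity
  have h4 : (1 + s - 1) = s := by ring
  rw [h4] at h
  have h5 : (1 / ((0 : ℕ) : ℝ) ^ (1 + s)) = 0 := by
    rw [Nat.cast_zero, Real.zero_rpow (by positivity)]; simp
  rw [h5]
  push_cast
  linarith

/-- the weight `e^{-mn/Y}/(mn)` -/
noncomputable def wt (Y : ℝ) (p : ℕ × ℕ) : ℝ :=
  Real.exp (-((p.1 : ℝ) * p.2) / Y) / ((p.1 : ℝ) * p.2)

lemma wt_nonneg (Y : ℝ) (p : ℕ × ℕ) : 0 ≤ wt Y p := by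
  unfold wt; positivity

lemma exp_neg_le_rpow {t s : ℝ} (ht : 0 < t) (hs : 0 < s) (hs1 : s ≤ 1) :
    Real.exp (-t) ≤ t ^ (-s) := by
  rw [Real.exp_neg, Real.rpow_neg ht.le]
  apply inv_anti₀ (by positivity)
  have h1 : 1 ≤ Real.exp t := Real.one_le_exp ht.le
  calc t ^ s ≤ (Real.exp t) ^ s :=
        Real.rpow_le_rpow ht.le (by linarith [Real.add_one_le_exp t]) hs.le
    _ ≤ (Real.exp t) ^ (1 : ℝ) := Real.rpow_le_rpow_of_exponent_le h1 hs1
    _ = _ := Real.rpow_one _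

lemma wt_le {Y s : ℝ} (hY : 0 < Y) (hs : 0 < s) (hs1 : s ≤ 1) (p : ℕ × ℕ) :
    wt Y p ≤ Y ^ s * (1 / (p.1 : ℝ) ^ (1 + s) * (1 / (p.2 : ℝ) ^ (1 + s))) := by
  obtain ⟨m, n⟩ := p
  unfold wt
  rcases Nat.eq_zero_or_pos m with rfl | hm
  · simp; positivity
  rcases Nat.eq_zero_or_pos n with rfl | hn
  · simp; positivity
  have hm' : (0 : ℝ) < m := by exact_mod_cast hm
  have hn' : (0 : ℝ) < n := by exact_mod_cast hn
  have h := exp_neg_le_rpow (t := (m : ℝ) * n / Y) (by positivity) hs hs1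
  simp only
  rw [neg_div]
  calc _ ≤ ((m : ℝ) * n / Y) ^ (-s) / (m * n) := by gcongr
    _ = _ := by
      rw [Real.rpow_add hm', Real.rpow_add hn', Real.rpow_one, Real.rpow_one,
        Real.rpow_neg (by positivity), Real.div_rpow (by positivity) hY.le,
        Real.mul_rpow hm'.le hn'.le]
      have := (Real.rpow_pos_of_pos hm' s).ne'
      have := (Real.rpow_pos_of_pos hn' s).ne'
      have := (Real.rpow_pos_of_pos hY s).ne'
      field_simp

lemma prod_summable {s : ℝ} (hs : 0 < s) : Summable (fun p : ℕ × ℕ =>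
    1 / (p.1 : ℝ) ^ (1 + s) * (1 / (p.2 : ℝ) ^ (1 + s))) :=
  (pseries_summable hs).mul_of_nonneg (pseries_summable hs)
    (fun _ => by positivity) (fun _ => by positivity)

lemma wt_summable {Y : ℝ} (hY : 0 < Y) : Summable (wt Y) :=
  Summable.of_nonneg_of_le (wt_nonneg Y) (wt_le hY one_pos le_rfl)
    ((prod_summable one_pos).mul_left _)

lemma tsum_wt_le {Y s : ℝ} (hY : 0 < Y) (hs : 0 < s) (hs1 : s ≤ 1) :
    ∑' p, wt Y p ≤ Y ^ s * (1 + 1 / s) ^ 2 := by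
  calc ∑' p, wt Y p ≤ ∑' p : ℕ × ℕ, Y ^ s *
        (1 / (p.1 : ℝ) ^ (1 + s) * (1 / (p.2 : ℝ) ^ (1 + s))) :=
        (wt_summable hY).tsum_le_tsum (wt_le hY hs hs1) ((prod_summable hs).mul_left _)
    _ = Y ^ s * ((∑' n : ℕ, 1 / (n : ℝ) ^ (1 + s)) * (∑' n : ℕ, 1 / (n : ℝ) ^ (1 + s))) := by
        rw [tsum_mul_left, (pseries_summable hs).tsum_mul_tsum (pseries_summable hs)
          (prod_summable hs)]
    _ ≤ _ := by
        rw [sq]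
        have h0 : 0 ≤ ∑' n : ℕ, 1 / (n : ℝ) ^ (1 + s) := tsum_nonneg fun _ => by positivity
        have := pseries_le hs
        gcongr

lemma tsum_wt_le' : ∀ X : ℝ, 1 < X →
    ∑' p, wt (2 * X) p ≤ 100 * (X ^ (-(1 : ℝ) / 2) + Real.log X ^ 2) := by
  intro X hX
  have hX0 : 0 < X := by linarith
  rcases le_or_gt X 2 with h2 | h2
  · have h := tsum_wt_le (Y := 2 * X) (s := 1) (by linarith) one_pos le_rfl
    have h3 : (1 / 2 : ℝ) ≤ X ^ (-(1 : ℝ) / 2) := by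
      calc (1 / 2 : ℝ) ≤ X ^ (-1 : ℝ) := by
            rw [Real.rpow_neg_one, one_div]; exact inv_anti₀ hX0 h2
        _ ≤ _ := Real.rpow_le_rpow_of_exponent_le hX.le (by norm_num)
    rw [Real.rpow_one] at h
    have := sq_nonneg (Real.log X)
    linarith
  · have hl2 := Real.log_two_gt_d9
    have hlX : Real.log 2 ≤ Real.log X := Real.log_le_log (by norm_num) h2.le
    have hL : Real.log (2 * X) = Real.log 2 + Real.log X :=
      Real.log_mul (by norm_num) hX0.ne'
    have hL1 : 1 ≤ Real.log (2 * X) := by rw [hL]; linarith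
    have h := tsum_wt_le (Y := 2 * X) (s := 1 / Real.log (2 * X)) (by linarith) (by positivity)
      (by rw [div_le_one (by linarith)]; exact hL1)
    have he : (2 * X) ^ (1 / Real.log (2 * X)) = Real.exp 1 := by
      rw [Real.rpow_def_of_pos (by linarith), mul_one_div_cancel (by linarith)]
    rw [he, one_div_one_div] at h
    have h5 : 1 + Real.log (2 * X) ≤ 5 * Real.log X := by rw [hL]; linarith
    have h6 : (1 + Real.log (2 * X)) ^ 2 ≤ (5 * Real.log X) ^ 2 := by gcongr
    have h7 := Real.exp_one_lt_d9
    have h8 : 0 ≤ X ^ (-(1 : ℝ) / 2) := by positivity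
    calc _ ≤ Real.exp 1 * (5 * Real.log X) ^ 2 := h.trans (by gcongr)
      _ ≤ 4 * (5 * Real.log X) ^ 2 := by gcongr; linarith
      _ ≤ _ := by nlinarith

/-- comparison of a sum over a subset via an injection -/
lemma tsum_inj_le {X : ℝ} (hX : 0 < X) {l : ℕ} (hl : 0 < l) (P : ℕ × ℕ → Prop) [DecidablePred P]
    (e : ℕ × ℕ → ℕ × ℕ) (hinj : ∀ p p', P p → P p' → e p = e p' → p = p')
    (hpos : ∀ p, P p → 0 < (e p).1 * (e p).2)
    (hle : ∀ p, P p → l * ((e p).1 * (e p).2) ≤ 2 * (p.1 * p.2)) :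
    ∑' p, (if P p then wt X p else 0) ≤ 2 / l * ∑' p, wt (2 * X) p := by
  have hl' : (1 : ℝ) ≤ l := by exact_mod_cast hl
  have h0 : ∀ p, (if P p then wt X p else 0) = Set.indicator {p | P p} (wt X) p := by
    intro p; simp [Set.indicator]
  simp only [h0]
  rw [← tsum_subtype, ← tsum_mul_left]
  refine Summable.tsum_le_tsum_of_inj (fun p : {p | P p} => e p) ?_ ?_ ?_ ?_ ?_
  · intro p p' h
    exact Subtype.ext (hinj _ _ p.2 p'.2 h)
  · intro c _
    have := wt_nonneg (2 * X) c
    positivity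
  · rintro ⟨p, hp⟩
    have h1 := hle p hp
    have h2 := hpos p hp
    simp only
    unfold wt
    set k := (e p).1
    set n := (e p).2
    have h1' : (l : ℝ) * ((k : ℝ) * n) ≤ 2 * ((p.1 : ℝ) * p.2) := by exact_mod_cast h1
    have h2' : (0 : ℝ) < (k : ℝ) * n := by exact_mod_cast h2
    have h3 : (0 : ℝ) < (l : ℝ) * ((k : ℝ) * n) := by positivity
    have h4 : (0 : ℝ) < (p.1 : ℝ) * p.2 := by linarith
    have h5 : (k : ℝ) * n ≤ (l : ℝ) * ((k : ℝ) * n) := le_mul_of_one_le_left h2'.le hl'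
    have h6 : Real.exp (-((p.1 : ℝ) * p.2) / X) ≤ Real.exp (-((k : ℝ) * n) / (2 * X)) := by
      apply Real.exp_le_exp.mpr
      rw [div_le_div_iff₀ hX (by linarith)]
      nlinarith
    calc _ ≤ Real.exp (-((k : ℝ) * n) / (2 * X)) / ((p.1 : ℝ) * p.2) := by gcongr
      _ ≤ Real.exp (-((k : ℝ) * n) / (2 * X)) / ((l : ℝ) * ((k : ℝ) * n) / 2) := by
          gcongr; linarith
      _ = _ := by field_simp
  · exact (wt_summable hX).subtype _
  · exact (wt_summable (by linarith)).mul_left _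

lemma offdiag_le {X : ℝ} (hX : 1 < X) {l : ℕ} (hl : 0 < l) :
    ∑' p : ℕ × ℕ, wt X p * ((if ((p.1 : ℤ) : ZMod l) = ((p.2 : ℤ) : ZMod l) ∧ p.1 ≠ p.2 then 1 else 0) +
      (if ((-(p.1 : ℤ) : ℤ) : ZMod l) = ((p.2 : ℤ) : ZMod l) then 1 else 0)) ≤
      8 / l * ∑' p, wt (2 * X) p := by
  have hX0 : 0 < X := by linarith
  have hdec1 : ∀ m n : ℕ, ((m : ℤ) : ZMod l) = ((n : ℤ) : ZMod l) ↔ (l : ℤ) ∣ (n : ℤ) - m := by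
    intro m n
    rw [ZMod.intCast_eq_intCast_iff_dvd_sub]
  have hdec2 : ∀ m n : ℕ, ((-(m : ℤ) : ℤ) : ZMod l) = ((n : ℤ) : ZMod l) ↔ l ∣ n + m := by
    intro m n
    rw [ZMod.intCast_eq_intCast_iff_dvd_sub]
    rw [sub_neg_eq_add]
    exact_mod_cast Iff.rfl
  set P1 : ℕ × ℕ → Prop := fun p => 0 < p.1 ∧ p.1 < p.2 ∧ l ∣ p.2 - p.1 with hP1
  set P2 : ℕ × ℕ → Prop := fun p => 0 < p.2 ∧ p.2 < p.1 ∧ l ∣ p.1 - p.2 with hP2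
  set P3 : ℕ × ℕ → Prop := fun p => 0 < p.1 ∧ p.1 ≤ p.2 ∧ l ∣ p.2 + p.1 with hP3
  set P4 : ℕ × ℕ → Prop := fun p => 0 < p.2 ∧ p.2 < p.1 ∧ l ∣ p.2 + p.1 with hP4
  classical
  have b1 := tsum_inj_le hX0 hl P1 (fun p => ((p.2 - p.1) / l, p.1))
    (by
      rintro ⟨m, n⟩ ⟨m', n'⟩ ⟨h1, h2, h3⟩ ⟨h1', h2', h3'⟩ h
      simp only [Prod.mk.injEq] at *
      obtain ⟨h, rfl⟩ := h
      have e1 := Nat.div_mul_cancel h3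
      have e2 := Nat.div_mul_cancel h3'
      rw [h] at e1
      omega)
    (by
      rintro ⟨m, n⟩ ⟨h1, h2, h3⟩
      simp only at *
      exact Nat.mul_pos (Nat.div_pos (Nat.le_of_dvd (by omega) h3) hl) h1)
    (by
      rintro ⟨m, n⟩ ⟨h1, h2, h3⟩
      simp only at *
      rw [← mul_assoc, Nat.mul_div_cancel' h3]
      have : (n - m) * m ≤ n * m := Nat.mul_le_mul_right _ (Nat.sub_le _ _)
      nlinarith)
  have b2 := tsum_inj_le hX0 hl P2 (fun p => ((p.1 - p.2) / l, p.2))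
    (by
      rintro ⟨m, n⟩ ⟨m', n'⟩ ⟨h1, h2, h3⟩ ⟨h1', h2', h3'⟩ h
      simp only [Prod.mk.injEq] at *
      obtain ⟨h, rfl⟩ := h
      have e1 := Nat.div_mul_cancel h3
      have e2 := Nat.div_mul_cancel h3'
      rw [h] at e1
      omega)
    (by
      rintro ⟨m, n⟩ ⟨h1, h2, h3⟩
      simp only at *
      exact Nat.mul_pos (Nat.div_pos (Nat.le_of_dvd (by omega) h3) hl) h1)
    (by
      rintro ⟨m, n⟩ ⟨h1, h2, h3⟩
      simp only at *
      rw [← mul_assoc, Nat.mul_div_cancel' h3]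
      have : (m - n) * n ≤ m * n := Nat.mul_le_mul_right _ (Nat.sub_le _ _)
      nlinarith)
  have b3 := tsum_inj_le hX0 hl P3 (fun p => ((p.2 + p.1) / l, p.1))
    (by
      rintro ⟨m, n⟩ ⟨m', n'⟩ ⟨h1, h2, h3⟩ ⟨h1', h2', h3'⟩ h
      simp only [Prod.mk.injEq] at *
      obtain ⟨h, rfl⟩ := h
      have e1 := Nat.div_mul_cancel h3
      have e2 := Nat.div_mul_cancel h3'
      rw [h] at e1
      omega)
    (by
      rintro ⟨m, n⟩ ⟨h1, h2, h3⟩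
      simp only at *
      exact Nat.mul_pos (Nat.div_pos (Nat.le_of_dvd (by omega) h3) hl) h1)
    (by
      rintro ⟨m, n⟩ ⟨h1, h2, h3⟩
      simp only at *
      rw [← mul_assoc, Nat.mul_div_cancel' h3]
      nlinarith)
  have b4 := tsum_inj_le hX0 hl P4 (fun p => ((p.2 + p.1) / l, p.2))
    (by
      rintro ⟨m, n⟩ ⟨m', n'⟩ ⟨h1, h2, h3⟩ ⟨h1', h2', h3'⟩ h
      simp only [Prod.mk.injEq] at *
      obtain ⟨h, rfl⟩ := h
      have e1 := Nat.div_mul_cancel h3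
      have e2 := Nat.div_mul_cancel h3'
      rw [h] at e1
      omega)
    (by
      rintro ⟨m, n⟩ ⟨h1, h2, h3⟩
      simp only at *
      exact Nat.mul_pos (Nat.div_pos (Nat.le_of_dvd (by omega) h3) hl) h1)
    (by
      rintro ⟨m, n⟩ ⟨h1, h2, h3⟩
      simp only at *
      rw [← mul_assoc, Nat.mul_div_cancel' h3]
      nlinarith)
  have hs : ∀ (P : ℕ × ℕ → Prop) [DecidablePred P], Summable (fun p => if P p then wt X p else 0) := by
    intro P _
    refine Summable.of_nonneg_of_le (fun p => ?_) (fun p => ?_) (wt_summable hX0)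
    · split_ifs
      exacts [wt_nonneg _ _, le_rfl]
    · split_ifs
      exacts [le_rfl, wt_nonneg _ _]
  have hpt : ∀ p : ℕ × ℕ, wt X p * ((if ((p.1 : ℤ) : ZMod l) = ((p.2 : ℤ) : ZMod l) ∧ p.1 ≠ p.2 then 1 else 0) +
      (if ((-(p.1 : ℤ) : ℤ) : ZMod l) = ((p.2 : ℤ) : ZMod l) then 1 else 0)) =
      ((if P1 p then wt X p else 0) + (if P2 p then wt X p else 0)) +
      ((if P3 p then wt X p else 0) + (if P4 p then wt X p else 0)) := by
    rintro ⟨m, n⟩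
    simp only [hdec1, hdec2, hP1, hP2, hP3, hP4]
    rcases Nat.eq_zero_or_pos m with rfl | hm
    · simp [wt]
    rcases Nat.eq_zero_or_pos n with rfl | hn
    · simp [wt]
    rw [mul_add]
    congr 1
    · rcases lt_trichotomy m n with h | h | h
      · have : (l : ℤ) ∣ (n : ℤ) - m ↔ l ∣ n - m := by
          rw [← Nat.cast_sub h.le]; exact_mod_cast Iff.rfl
        simp [this, hm, h, h.ne, h.not_gt]
      · simp [h]
      · have : (l : ℤ) ∣ (n : ℤ) - m ↔ l ∣ m - n := by
          rw [dvd_sub_comm, ← Nat.cast_sub h.le]; exact_mod_cast Iff.rfl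
        simp [this, hn, h, h.ne', h.not_gt]
    · rcases le_or_gt m n with h | h
      · simp [hm, h, h.not_gt]
      · simp [hn, h, h.not_ge]
  simp only [hpt]
  rw [((hs P1).add (hs P2)).tsum_add ((hs P3).add (hs P4)), (hs P1).tsum_add (hs P2),
    (hs P3).tsum_add (hs P4)]
  have : (8 : ℝ) / l = 2 / l + 2 / l + 2 / l + 2 / l := by ring
  rw [this]
  linarith

lemma offdiag_le' {X : ℝ} (hX : 1 < X) {l : ℕ} (hl : 0 < l) :
    ∑' p : ℕ × ℕ, wt X p * ((if ((p.1 : ℤ) : ZMod l) = ((p.2 : ℤ) : ZMod l) ∧ p.1 ≠ p.2 then 1 else 0) +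
      (if ((-(p.1 : ℤ) : ℤ) : ZMod l) = ((p.2 : ℤ) : ZMod l) then 1 else 0)) ≤
      800 * (X ^ (-(1 : ℝ) / 2) + Real.log X ^ 2 / l) := by
  refine (offdiag_le hX hl).trans ?_
  have hl' : (1 : ℝ) ≤ l := by exact_mod_cast hl
  have h8 : 0 ≤ X ^ (-(1 : ℝ) / 2) := Real.rpow_nonneg (by linarith) _
  calc (8 : ℝ) / l * ∑' p, wt (2 * X) p
      ≤ 8 / l * (100 * (X ^ (-(1 : ℝ) / 2) + Real.log X ^ 2)) := by
        gcongr; exact tsum_wt_le' X hX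
    _ = 800 * (X ^ (-(1 : ℝ) / 2) / l + Real.log X ^ 2 / l) := by ring
    _ ≤ _ := by
        gcongr
        exact div_le_self h8 hl'

/-- the coefficient of the diagonal series -/
noncomputable def dcoef (q n : ℕ) : ℝ :=
  if n.Coprime q then ((moebius n : ℤ) : ℝ) ^ 2 / (n : ℝ) ^ 2 else 0

lemma dcoef_nonneg (q n : ℕ) : 0 ≤ dcoef q n := by
  unfold dcoef; split_ifs <;> positivity

lemma dcoef_le (q n : ℕ) : dcoef q n ≤ 1 / (n : ℝ) ^ 2 := by
  unfold dcoef
  split_ifs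
  · gcongr
    have h : |moebius n| ≤ 1 := abs_moebius_le_one
    exact_mod_cast (sq_le_one_iff_abs_le_one _).mpr h
  · positivity

lemma dcoef_summable (q : ℕ) : Summable (dcoef q) :=
  Summable.of_nonneg_of_le (dcoef_nonneg q) (dcoef_le q)
    (Real.summable_one_div_nat_pow.mpr (by norm_num))

lemma diag_bound (q : ℕ) {X : ℝ} (hX : 1 < X) :
    |∑' n : ℕ, dcoef q n * Real.exp (-((n : ℝ) * n) / X) - ∑' n : ℕ, dcoef q n| ≤
      4 * X ^ (-(1 : ℝ) / 2) := by
  have hX0 : 0 < X := by linarith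
  have hle1 : ∀ n : ℕ, Real.exp (-((n : ℝ) * n) / X) ≤ 1 := by
    intro n
    rw [Real.exp_le_one_iff, neg_div]
    have : 0 ≤ (n : ℝ) * n / X := by positivity
    linarith
  have hs1 : Summable (fun n : ℕ => dcoef q n * Real.exp (-((n : ℝ) * n) / X)) :=
    Summable.of_nonneg_of_le (fun n => mul_nonneg (dcoef_nonneg _ _) (Real.exp_nonneg _))
      (fun n => mul_le_of_le_one_right (dcoef_nonneg _ _) (hle1 n)) (dcoef_summable q)
  rw [abs_sub_comm, ← (dcoef_summable q).tsum_sub hs1]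
  have hnn : ∀ n, 0 ≤ dcoef q n - dcoef q n * Real.exp (-((n : ℝ) * n) / X) := fun n =>
    sub_nonneg.mpr (mul_le_of_le_one_right (dcoef_nonneg _ _) (hle1 n))
  rw [abs_of_nonneg (tsum_nonneg hnn)]
  set a := Real.sqrt X with ha
  have ha1 : 1 ≤ a := Real.one_le_sqrt.mpr hX.le
  have ha2 : a ^ 2 = X := Real.sq_sqrt hX0.le
  have hXa : X ^ (-(1 : ℝ) / 2) = 1 / a := by
    rw [ha, Real.sqrt_eq_rpow, neg_div, Real.rpow_neg hX0.le, one_div, one_div]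
  rw [hXa]
  have hz : dcoef q 0 - dcoef q 0 * Real.exp (-(((0 : ℕ) : ℝ) * (0 : ℕ)) / X) = 0 := by simp
  rw [((dcoef_summable q).sub hs1).tsum_eq_zero_add, hz, zero_add]
  refine Real.tsum_le_of_sum_range_le (fun n => hnn _) fun N => ?_
  have hterm : ∀ n : ℕ, dcoef q (n + 1) -
      dcoef q (n + 1) * Real.exp (-(((n + 1 : ℕ) : ℝ) * (n + 1 : ℕ)) / X) ≤
      4 * (1 / ((n : ℝ) + a)) - 4 * (1 / (((n + 1 : ℕ) : ℝ) + a)) := by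
    intro n
    set x : ℝ := ((n + 1 : ℕ) : ℝ) with hx
    have hxn : x = n + 1 := by rw [hx]; push_cast; ring
    have hn0 : (0 : ℝ) ≤ n := by positivity
    have hx0 : 0 < x := by linarith
    have hd := dcoef_le q (n + 1)
    rw [← hx] at hd
    have h1 : dcoef q (n + 1) - dcoef q (n + 1) * Real.exp (-(x * x) / X) ≤
        1 / x ^ 2 * (1 - Real.exp (-(x * x) / X)) := by
      have := hle1 (n + 1)
      rw [← hx] at this
      nlinarith
    have h2 : 1 - Real.exp (-(x * x) / X) ≤ x ^ 2 / X := by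
      have := Real.add_one_le_exp (-(x * x) / X)
      have h : -(x * x) / X = - (x ^ 2 / X) := by ring
      rw [h] at this ⊢
      linarith
    have h3 : 1 - Real.exp (-(x * x) / X) ≤ 1 := by
      linarith [Real.exp_nonneg (-(x * x) / X)]
    have h4 : 1 / x ^ 2 * (1 - Real.exp (-(x * x) / X)) ≤ 4 / (x + a) ^ 2 := by
      rcases le_total x a with h | h
      · calc _ ≤ 1 / x ^ 2 * (x ^ 2 / X) := by gcongr
          _ = 1 / a ^ 2 := by rw [ha2]; field_simp
          _ = 4 / (a + a) ^ 2 := by ring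
          _ ≤ _ := by gcongr
      · calc _ ≤ 1 / x ^ 2 * 1 := by gcongr
          _ = 4 / (x + x) ^ 2 := by ring
          _ ≤ _ := by gcongr
    refine h1.trans (h4.trans ?_)
    have h5 : 4 * (1 / ((n : ℝ) + a)) - 4 * (1 / (x + a)) = 4 / (((n : ℝ) + a) * (x + a)) := by
      rw [hxn]; field_simp; ring
    rw [h5, sq]
    gcongr
    linarith
  refine (Finset.sum_le_sum fun n _ => hterm n).trans ?_
  rw [Finset.sum_range_sub' (fun n : ℕ => 4 * (1 / ((n : ℝ) + a)))]
  have : 0 ≤ 4 * (1 / ((N : ℝ) + a)) := by positivity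
  simp only [Nat.cast_zero, zero_add]
  linarith

lemma dcoef_euler (q : ℕ) (hq : q ≠ 0) :
    ((∑' n, dcoef q n : ℝ) : ℂ) * ((∏ p ∈ q.primeFactors, (1 + ((p : ℝ) ^ 2)⁻¹) : ℝ) : ℂ) *
      riemannZeta 4 = riemannZeta 2 := by
  have h1 : HasProd (fun p : Nat.Primes ↦ ∑' e, dcoef q (p ^ e)) (∑' n, dcoef q n) := by
    refine EulerProduct.eulerProduct_hasProd (f := dcoef q) ?_ ?_ ?_ ?_
    · simp [dcoef]
    · intro m n hmn
      unfold dcoef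
      rw [isMultiplicative_moebius.map_mul_of_coprime hmn]
      simp only [Nat.coprime_mul_iff_left]
      split_ifs <;> first | (exfalso; tauto) | (push_cast; ring)
    · simpa [abs_of_nonneg (dcoef_nonneg q _)] using dcoef_summable q
    · simp [dcoef]
  have h2 : ∀ p : Nat.Primes, ∑' e, dcoef q (p ^ e) =
      if (p : ℕ) ∣ q then 1 else 1 + ((p : ℝ) ^ 2)⁻¹ := by
    intro p
    have hp := p.2
    rw [tsum_eq_sum (s := Finset.range 2)]
    · rw [Finset.sum_range_succ, Finset.sum_range_one]
      simp only [pow_zero, pow_one, dcoef]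
      rw [moebius_apply_prime hp]
      simp only [hp.coprime_iff_not_dvd]
      by_cases h : (p : ℕ) ∣ q <;> simp [h]
    · intro e he
      simp only [Finset.mem_range, not_lt] at he
      unfold dcoef
      rw [moebius_apply_prime_pow hp (by omega), if_neg (by omega : ¬ e = 1)]
      simp
  simp only [h2] at h1
  have h3 : HasProd (fun p : Nat.Primes ↦ if (p : ℕ) ∣ q then 1 + ((p : ℝ) ^ 2)⁻¹ else 1)
      (∏ p ∈ q.primeFactors, (1 + ((p : ℝ) ^ 2)⁻¹)) := by
    let s : Finset Nat.Primes := q.primeFactors.subtype Nat.Prime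
    have hs : ∀ p : Nat.Primes, p ∈ s ↔ (p : ℕ) ∈ q.primeFactors := fun p => Finset.mem_subtype
    have hprod : ∏ p ∈ s, (if (p : ℕ) ∣ q then 1 + ((p : ℝ) ^ 2)⁻¹ else 1) =
        ∏ p ∈ q.primeFactors, (1 + ((p : ℝ) ^ 2)⁻¹) := by
      refine Finset.prod_bij (fun (p : Nat.Primes) _ => (p : ℕ)) ?_ ?_ ?_ ?_
      · intro p hp; exact (hs p).mp hp
      · intro p _ p' _ h; exact Subtype.ext h
      · intro p hp
        exact ⟨⟨p, Nat.prime_of_mem_primeFactors hp⟩, (hs _).mpr hp, rfl⟩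
      · intro p hp
        rw [if_pos (Nat.dvd_of_mem_primeFactors ((hs p).mp hp))]
    rw [← hprod]
    refine hasProd_prod_of_ne_finset_one ?_
    intro p hp
    rw [if_neg]
    intro h
    exact hp ((hs p).mpr (Nat.mem_primeFactors.mpr ⟨p.2, h, hq⟩))
  have h4 := h1.mul h3
  have h5 : HasProd (fun p : Nat.Primes => ((1 + ((p : ℝ) ^ 2)⁻¹ : ℝ) : ℂ))
      (((∑' n, dcoef q n) * ∏ p ∈ q.primeFactors, (1 + ((p : ℝ) ^ 2)⁻¹) : ℝ) : ℂ) := by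
    have := h4.map Complex.ofRealHom Complex.continuous_ofReal
    suffices hfun : (fun p : Nat.Primes => ((1 + ((p : ℝ) ^ 2)⁻¹ : ℝ) : ℂ)) = Complex.ofRealHom ∘ fun p : Nat.Primes =>
        (if (p : ℕ) ∣ q then 1 else 1 + ((p : ℝ) ^ 2)⁻¹) *
          if (p : ℕ) ∣ q then 1 + ((p : ℝ) ^ 2)⁻¹ else 1  by
      rw [hfun]; exact this
    funext p
    simp only [Function.comp, Complex.ofRealHom_eq_coe]
    split_ifs <;> simp
  have h6 := riemannZeta_eulerProduct_hasProd (s := 4) (by norm_num)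
  have h7 := riemannZeta_eulerProduct_hasProd (s := 2) (by norm_num)
  have h8 := h5.mul h6
  rw [← Complex.ofReal_mul]
  refine h8.unique ?_
  convert h7 using 1
  funext p
  have hp : (1 : ℝ) < (p : ℕ) := by exact_mod_cast p.2.one_lt
  have e4 : ((p : ℕ) : ℂ) ^ (-4 : ℂ) = ((((p : ℕ) : ℝ) ^ 4)⁻¹ : ℝ) := by
    rw [Complex.cpow_neg]
    push_cast
    congr 1
    exact_mod_cast Complex.cpow_natCast ((p : ℕ) : ℂ) 4
  have e2 : ((p : ℕ) : ℂ) ^ (-2 : ℂ) = ((((p : ℕ) : ℝ) ^ 2)⁻¹ : ℝ) := by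
    rw [Complex.cpow_neg]
    push_cast
    congr 1
    exact_mod_cast Complex.cpow_natCast ((p : ℕ) : ℂ) 2
  rw [e4, e2, ← Complex.ofReal_one, ← Complex.ofReal_sub, ← Complex.ofReal_sub,
    ← Complex.ofReal_inv, ← Complex.ofReal_inv, ← Complex.ofReal_mul]
  congr 1
  set x : ℝ := ((p : ℕ) : ℝ)
  have hx2 : 1 < x ^ 2 := by nlinarith
  have hx4 : 1 < x ^ 4 := by nlinarith
  have a1 : x ^ 2 - 1 ≠ 0 := by linarith
  have a2 : x ^ 4 - 1 ≠ 0 := by linarith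
  have b1 : 1 - (x ^ 2)⁻¹ ≠ 0 := by
    have : 1 - (x ^ 2)⁻¹ = (x ^ 2 - 1) / x ^ 2 := by field_simp
    rw [this]; positivity
  have b2 : 1 - (x ^ 4)⁻¹ = (1 - (x ^ 2)⁻¹) * (1 + (x ^ 2)⁻¹) := by ring
  rw [b2, mul_inv, mul_comm, mul_assoc, inv_mul_cancel₀ (by positivity), mul_one]

lemma main_const (q : ℕ) (hq : q ≠ 0) :
    (riemannZeta 2 / (2 * riemannZeta 4)).re * (∏ p ∈ q.primeFactors, (1 + ((p : ℝ) ^ 2)⁻¹)⁻¹) =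
      (∑' n, dcoef q n) / 2 := by
  have h := dcoef_euler q hq
  have h4 : riemannZeta 4 ≠ 0 := riemannZeta_ne_zero_of_one_le_re (by norm_num)
  set P := ∏ p ∈ q.primeFactors, (1 + ((p : ℝ) ^ 2)⁻¹)
  have hP : P ≠ 0 := Finset.prod_ne_zero_iff.mpr fun p _ => by positivity
  have h5 : riemannZeta 2 / (2 * riemannZeta 4) = (((∑' n, dcoef q n) * P / 2 : ℝ) : ℂ) := by
    rw [← h]
    push_cast
    field_simp
  rw [h5, Complex.ofReal_re, Finset.prod_inv_distrib]
  change _ * P⁻¹ = _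
  field_simp

/-- The complex weight. -/
noncomputable def cwt (X : ℝ) (p : ℕ × ℕ) : ℂ :=
  (moebius p.1 : ℂ) * (moebius p.2 : ℂ) / (p.1 * p.2 : ℂ) * Complex.exp (-(p.1 * p.2 : ℂ) / X)

lemma cwt_eq (X : ℝ) (p : ℕ × ℕ) :
    cwt X p = (((moebius p.1 : ℤ) : ℝ) * ((moebius p.2 : ℤ) : ℝ) * wt X p : ℝ) := by
  unfold cwt wt
  push_cast
  ring

lemma abs_moebius_real_le (n : ℕ) : |((moebius n : ℤ) : ℝ)| ≤ 1 := by
  exact_mod_cast (abs_moebius_le_one : |moebius n| ≤ 1)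

lemma norm_cwt_le {X : ℝ} (_hX : 0 < X) (p : ℕ × ℕ) : ‖cwt X p‖ ≤ wt X p := by
  rw [cwt_eq, Complex.norm_real, Real.norm_eq_abs, abs_mul, abs_mul, abs_of_nonneg (wt_nonneg X p)]
  have h1 := abs_moebius_real_le p.1
  have h2 := abs_moebius_real_le p.2
  have h3 := wt_nonneg X p
  calc _ ≤ 1 * 1 * wt X p := by gcongr
    _ = _ := by ring

open scoped Classical in
/-- The kernel: weighted sum over nonprincipal even characters. -/
noncomputable def kern (b q : ℕ) [NeZero q] (p : ℕ × ℕ) : ℂ :=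
  ∑ χ : DirichletCharacter ℂ q, (if χ ≠ 1 ∧ χ.Even then ((χ.conductor : ℂ) ^ b)⁻¹ else 0) *
    (χ (p.1 : ZMod q) * (starRingEnd ℂ) (χ (p.2 : ZMod q)))

/-- The diagonal part of the kernel. -/
noncomputable def diagc (q : ℕ) (M : ℝ) (p : ℕ × ℕ) : ℂ :=
  if p.1 = p.2 ∧ p.1.Coprime q then ((M / 2 : ℝ) : ℂ) else 0

/-- The off-diagonal congruence indicator. -/
noncomputable def ind (l : ℕ) (p : ℕ × ℕ) : ℝ :=
  (if ((p.1 : ℤ) : ZMod l) = ((p.2 : ℤ) : ZMod l) ∧ p.1 ≠ p.2 then 1 else 0) +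
      (if ((-(p.1 : ℤ) : ℤ) : ZMod l) = ((p.2 : ℤ) : ZMod l) then 1 else 0)

lemma ind_nonneg (l : ℕ) (p : ℕ × ℕ) : 0 ≤ ind l p := by
  unfold ind
  split_ifs <;> norm_num

lemma ind_le (l : ℕ) (p : ℕ × ℕ) : ind l p ≤ 2 := by
  unfold ind
  split_ifs <;> norm_num

lemma hasSum_off (b q : ℕ) {X : ℝ} (hX : 1 < X) :
    HasSum (fun p : ℕ × ℕ => ∑ d ∈ q.divisors.filter (fun d => 1 < d), ((d : ℝ) ^ b)⁻¹ *
        ∑ l ∈ d.divisors, (l.totient : ℝ) * (wt X p * ind l p))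
      (∑ d ∈ q.divisors.filter (fun d => 1 < d), ((d : ℝ) ^ b)⁻¹ *
        ∑ l ∈ d.divisors, (l.totient : ℝ) * ∑' p, wt X p * ind l p) := by
  refine hasSum_sum fun d _ => HasSum.mul_left _ (hasSum_sum fun l _ => HasSum.mul_left _ ?_)
  refine Summable.hasSum (Summable.of_nonneg_of_le
    (fun p => mul_nonneg (wt_nonneg _ _) (ind_nonneg _ _)) (fun p => ?_)
    ((wt_summable (by linarith : 0 < X)).mul_right 2))
  exact mul_le_mul_of_nonneg_left (ind_le _ _) (wt_nonneg _ _)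

lemma kern_eq (b q : ℕ) [NeZero q] (p : ℕ × ℕ) :
    kern b q p = ∑ d ∈ q.divisors.filter (fun d => 1 < d), ((d : ℂ) ^ b)⁻¹ *
      ((condSum q d (p.1 : ℤ) (p.2 : ℤ) + condSum q d (-(p.1 : ℤ)) (p.2 : ℤ)) / 2) := by
  classical
  unfold kern condSum
  simp only [← Finset.sum_add_distrib, Finset.sum_div, Finset.mul_sum]
  rw [Finset.sum_comm]
  refine Finset.sum_congr rfl fun χ _ => ?_
  have h1 : ∀ d : ℕ, ((d : ℂ) ^ b)⁻¹ * (((if χ.conductor = d then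
      χ (((p.1 : ℤ) : ZMod q)) * (starRingEnd ℂ) (χ (((p.2 : ℤ) : ZMod q))) else 0) +
      if χ.conductor = d then
      χ (((-(p.1 : ℤ) : ℤ) : ZMod q)) * (starRingEnd ℂ) (χ (((p.2 : ℤ) : ZMod q))) else 0) / 2) =
      if χ.conductor = d then ((d : ℂ) ^ b)⁻¹ * ((1 + χ (-1)) / 2 *
        (χ (p.1 : ZMod q) * (starRingEnd ℂ) (χ (p.2 : ZMod q)))) else 0 := by
    intro d
    split_ifs
    · have : χ (((-(p.1 : ℤ) : ℤ) : ZMod q)) = χ (-1) * χ (p.1 : ZMod q) := by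
        rw [← map_mul]; congr 1; push_cast; ring
      rw [this]
      push_cast
      ring
    · simp
  simp only [h1]
  rw [Finset.sum_ite_eq]
  have hc0 : χ.conductor ≠ 0 := χ.conductor_ne_zero
  have hmem : χ.conductor ∈ q.divisors.filter (fun d => 1 < d) ↔ χ ≠ 1 := by
    rw [Finset.mem_filter, Nat.mem_divisors, ne_eq χ, eq_one_iff_conductor_eq_one]
    constructor
    · rintro ⟨_, h⟩; omega
    · intro h; exact ⟨⟨χ.conductor_dvd_level, NeZero.ne q⟩, by omega⟩
  simp only [hmem]
  by_cases h : χ = 1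
  · simp [h]
  · rcases χ.even_or_odd with he | ho
    · rw [if_pos ⟨h, he⟩, if_pos h]
      have : χ (-1) = 1 := he
      rw [this]; ring
    · have hne : ¬ χ.Even := fun he => χ.not_even_and_odd ⟨he, ho⟩
      have : χ (-1) = -1 := ho
      rw [if_neg (fun hh => hne hh.2), if_pos h, this]; ring

lemma condSum_zero_left {q : ℕ} [NeZero q] (d : ℕ) {m n : ℤ}
    (h : ¬ (IsCoprime m (q : ℤ) ∧ IsCoprime n (q : ℤ))) : condSum q d m n = 0 := by
  unfold condSum
  refine Finset.sum_eq_zero fun χ _ => ?_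
  have : χ (m : ZMod q) = 0 ∨ χ (n : ZMod q) = 0 := by
    by_contra hh
    rw [not_or] at hh
    exact h ⟨(χ.apply_ne_zero_iff m).mp hh.1, (χ.apply_ne_zero_iff n).mp hh.2⟩
  rcases this with h | h <;> simp [h]

lemma kern_sub_le (b q : ℕ) [NeZero q] (p : ℕ × ℕ) :
    ‖kern b q p - diagc q (∑ d ∈ q.divisors.filter (fun d => 1 < d),
        (primitiveCharCount d : ℝ) / (d : ℝ) ^ b) p‖ ≤
      ∑ d ∈ q.divisors.filter (fun d => 1 < d), ((d : ℝ) ^ b)⁻¹ *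
        ∑ l ∈ d.divisors, (l.totient : ℝ) * ind l p := by
  have h1 : diagc q (∑ d ∈ q.divisors.filter (fun d => 1 < d),
        (primitiveCharCount d : ℝ) / (d : ℝ) ^ b) p =
      ∑ d ∈ q.divisors.filter (fun d => 1 < d), ((d : ℂ) ^ b)⁻¹ *
        ((if p.1 = p.2 ∧ p.1.Coprime q then (primitiveCharCount d : ℂ) else 0) / 2) := by
    unfold diagc
    split_ifs
    · push_cast
      rw [Finset.sum_div]
      refine Finset.sum_congr rfl fun d _ => ?_
      ring
    · simp
  rw [h1, kern_eq, ← Finset.sum_sub_distrib]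
  refine norm_sum_le_of_le _ fun d hd => ?_
  have hdq : d ∣ q := (Nat.mem_divisors.mp (Finset.mem_filter.mp hd).1).1
  rw [← mul_sub, norm_mul]
  have hn1 : ‖((d : ℂ) ^ b)⁻¹‖ = ((d : ℝ) ^ b)⁻¹ := by simp
  rw [hn1]
  gcongr
  have hR : 0 ≤ ∑ l ∈ d.divisors, (l.totient : ℝ) * ind l p :=
    Finset.sum_nonneg fun l _ => mul_nonneg (by positivity) (ind_nonneg _ _)
  have hcop : ∀ n : ℕ, IsCoprime (n : ℤ) (q : ℤ) ↔ n.Coprime q := fun n => Nat.isCoprime_iff_coprime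
  by_cases hc : IsCoprime (p.1 : ℤ) (q : ℤ) ∧ IsCoprime (p.2 : ℤ) (q : ℤ)
  · obtain ⟨hm, hn⟩ := hc
    have b2 := norm_condSum_le hdq hm.neg_left hn
    by_cases he : p.1 = p.2
    · rw [if_pos ⟨he, (hcop _).mp hm⟩]
      have e1 : condSum q d (p.1 : ℤ) (p.2 : ℤ) = primitiveCharCount d := by
        rw [← he]; exact condSum_self hdq hm
      rw [e1]
      have e2 : ((primitiveCharCount d : ℂ) + condSum q d (-(p.1 : ℤ)) (p.2 : ℤ)) / 2 -
          (primitiveCharCount d : ℂ) / 2 = condSum q d (-(p.1 : ℤ)) (p.2 : ℤ) / 2 := by ring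
      rw [e2, norm_div]
      have e3 : ‖condSum q d (-(p.1 : ℤ)) (p.2 : ℤ)‖ ≤
          ∑ l ∈ d.divisors, (l.totient : ℝ) * ind l p := by
        refine b2.trans (le_of_eq (Finset.sum_congr rfl fun l _ => ?_))
        unfold ind
        simp [he]
      simp only [Complex.norm_ofNat]
      linarith [norm_nonneg (condSum q d (-(p.1 : ℤ)) (p.2 : ℤ))]
    · rw [if_neg (fun h => he h.1), zero_div, sub_zero, norm_div]
      have b1 := norm_condSum_le hdq hm hn
      have e3 : ∑ l ∈ d.divisors, (l.totient : ℝ) * ind l p =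
          (∑ l ∈ d.divisors, if ((p.1 : ℤ) : ZMod l) = ((p.2 : ℤ) : ZMod l) then
            (l.totient : ℝ) else 0) +
          ∑ l ∈ d.divisors, if ((-(p.1 : ℤ) : ℤ) : ZMod l) = ((p.2 : ℤ) : ZMod l) then
            (l.totient : ℝ) else 0 := by
        rw [← Finset.sum_add_distrib]
        refine Finset.sum_congr rfl fun l _ => ?_
        unfold ind
        rw [mul_add]
        simp [he]
      have e4 := norm_add_le (condSum q d (p.1 : ℤ) (p.2 : ℤ)) (condSum q d (-(p.1 : ℤ)) (p.2 : ℤ))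
      have e5 : ‖(2 : ℂ)‖ = 2 := Complex.norm_ofNat 2
      rw [e5]
      linarith
  · rw [condSum_zero_left d hc, condSum_zero_left d (by rwa [IsCoprime.neg_left_iff]), if_neg]
    · simpa using hR
    · rintro ⟨h, h'⟩
      exact hc ⟨(hcop _).mpr h', (hcop _).mpr (h ▸ h')⟩

lemma tsum_diag {q : ℕ} {X : ℝ} (hX : 1 < X) (M : ℝ) :
    Summable (fun p : ℕ × ℕ => cwt X p * diagc q M p) ∧
    ∑' p : ℕ × ℕ, cwt X p * diagc q M p =
      ((M / 2 * ∑' n : ℕ, dcoef q n * Real.exp (-((n : ℝ) * n) / X) : ℝ) : ℂ) := by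
  constructor
  · refine Summable.of_norm_bounded ((wt_summable (by linarith : 0 < X)).mul_right |M / 2|)
      fun p => ?_
    rw [norm_mul]
    gcongr
    · exact wt_nonneg _ _
    · exact norm_cwt_le (by linarith) p
    · unfold diagc
      split_ifs
      · rw [Complex.norm_real, Real.norm_eq_abs]
      · simp
  · have hinj : Function.Injective (fun n : ℕ => (n, n)) := fun a b h => (Prod.mk.inj h).1
    rw [← hinj.tsum_eq (f := fun p : ℕ × ℕ => cwt X p * diagc q M p)]
    · rw [← tsum_mul_left, Complex.ofReal_tsum]
      refine tsum_congr fun n => ?_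
      rw [cwt_eq]
      unfold diagc dcoef wt
      by_cases h : n.Coprime q
      · rw [if_pos ⟨rfl, h⟩, if_pos h, ← Complex.ofReal_mul]
        congr 1
        simp only
        ring
      · rw [if_neg (fun hh => h hh.2), if_neg h]
        simp
    · rintro ⟨m, n⟩ h
      by_contra hh
      apply h
      simp only
      unfold diagc
      rw [if_neg, mul_zero]
      rintro ⟨h1, _⟩
      simp only at h1
      exact hh ⟨m, by simp [h1]⟩

open scoped Classical in
/-- For `𝔟 ∈ {0,1}`, `q ≥ 2` and `X > 1`, the sum
`S_𝔟(X) = Σ_{χ ≠ χ0 even} f_χ^{−𝔟} Σ_{m,n ≥ 1} μ(m)μ(n)χ(m)conj(χ)(n)/(mn) e^{−mn/X}`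
satisfies `S_𝔟(X) = (ζ(2)/(2ζ(4))) ∏_{p ∣ q}(1+p⁻²)⁻¹ Σ_{d ∣ q, d>1} φ*(d)/d^𝔟
 + O(X^{−1/2} Σ_{d ∣ q, d>1} d^{−𝔟} Σ_{l ∣ d} φ(l))
 + O((log X)² Σ_{d ∣ q, d>1} d^{−𝔟} Σ_{l ∣ d} φ(l)/l)` with absolute implied constants. -/
theorem smoothed_negative_moment_sum :
    ∃ C > (0 : ℝ), ∀ (b q : ℕ) [NeZero q], b ≤ 1 → 2 ≤ q → ∀ X : ℝ, 1 < X →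
      ‖(∑ χ : DirichletCharacter ℂ q,
          if χ ≠ 1 ∧ χ.Even then
            ((χ.conductor : ℂ) ^ b)⁻¹ *
              ∑' mn : ℕ × ℕ,
                if 1 ≤ mn.1 ∧ 1 ≤ mn.2 then
                  (moebius mn.1 : ℂ) * (moebius mn.2 : ℂ) * χ (mn.1 : ZMod q) *
                      (starRingEnd ℂ) (χ (mn.2 : ZMod q)) / (mn.1 * mn.2 : ℂ) *
                    Complex.exp (-(mn.1 * mn.2 : ℂ) / X)
                else 0
          else 0) -
        (((riemannZeta 2 / (2 * riemannZeta 4)).re *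
            (∏ p ∈ q.primeFactors, (1 + ((p : ℝ) ^ 2)⁻¹)⁻¹) *
            ∑ d ∈ q.divisors.filter (fun d => 1 < d),
              (primitiveCharCount d : ℝ) / (d : ℝ) ^ b : ℝ) : ℂ)‖ ≤
      C * (X ^ (-(1 : ℝ) / 2) *
            ∑ d ∈ q.divisors.filter (fun d => 1 < d),
              ((d : ℝ) ^ b)⁻¹ * ∑ l ∈ d.divisors, (l.totient : ℝ)) +
        C * ((Real.log X) ^ 2 *
            ∑ d ∈ q.divisors.filter (fun d => 1 < d),
              ((d : ℝ) ^ b)⁻¹ * ∑ l ∈ d.divisors, (l.totient : ℝ) / l) := by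
  refine ⟨1000, by norm_num, ?_⟩
  intro b q _ hb hq X hX
  have hX0 : 0 < X := by linarith
  have hq0 : q ≠ 0 := by omega
  rw [main_const q hq0]
  have hL : (∑ χ : DirichletCharacter ℂ q,
          if χ ≠ 1 ∧ χ.Even then
            ((χ.conductor : ℂ) ^ b)⁻¹ *
              ∑' mn : ℕ × ℕ,
                if 1 ≤ mn.1 ∧ 1 ≤ mn.2 then
                  (moebius mn.1 : ℂ) * (moebius mn.2 : ℂ) * χ (mn.1 : ZMod q) *
                      (starRingEnd ℂ) (χ (mn.2 : ZMod q)) / (mn.1 * mn.2 : ℂ) *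
                    Complex.exp (-(mn.1 * mn.2 : ℂ) / X)
                else 0
          else 0) = ∑' p : ℕ × ℕ, cwt X p * kern b q p := by
    have h1 : ∀ χ : DirichletCharacter ℂ q, (∑' mn : ℕ × ℕ,
                if 1 ≤ mn.1 ∧ 1 ≤ mn.2 then
                  (moebius mn.1 : ℂ) * (moebius mn.2 : ℂ) * χ (mn.1 : ZMod q) *
                      (starRingEnd ℂ) (χ (mn.2 : ZMod q)) / (mn.1 * mn.2 : ℂ) *
                    Complex.exp (-(mn.1 * mn.2 : ℂ) / X)
                else 0) =
        ∑' p : ℕ × ℕ, cwt X p * (χ (p.1 : ZMod q) * (starRingEnd ℂ) (χ (p.2 : ZMod q))) := by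
      intro χ
      refine tsum_congr ?_
      rintro ⟨m, n⟩
      unfold cwt
      rcases Nat.eq_zero_or_pos m with rfl | hm
      · simp
      rcases Nat.eq_zero_or_pos n with rfl | hn
      · simp
      rw [if_pos ⟨hm, hn⟩]
      simp only
      ring
    have hsum : ∀ χ : DirichletCharacter ℂ q, Summable (fun p : ℕ × ℕ =>
        cwt X p * (χ (p.1 : ZMod q) * (starRingEnd ℂ) (χ (p.2 : ZMod q)))) := by
      intro χ
      refine Summable.of_norm_bounded (wt_summable hX0) fun p => ?_
      rw [norm_mul, norm_mul, RCLike.norm_conj]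
      have a1 := χ.norm_le_one (p.1 : ZMod q)
      have a2 := χ.norm_le_one (p.2 : ZMod q)
      calc _ ≤ wt X p * (1 * 1) := by
            gcongr
            · exact wt_nonneg _ _
            · exact norm_cwt_le hX0 p
        _ = _ := by ring
    simp only [h1]
    have h2 : ∀ χ : DirichletCharacter ℂ q, (if χ ≠ 1 ∧ χ.Even then ((χ.conductor : ℂ) ^ b)⁻¹ *
        ∑' p : ℕ × ℕ, cwt X p * (χ (p.1 : ZMod q) * (starRingEnd ℂ) (χ (p.2 : ZMod q))) else 0) =
        ∑' p : ℕ × ℕ, (if χ ≠ 1 ∧ χ.Even then ((χ.conductor : ℂ) ^ b)⁻¹ else 0) *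
        (cwt X p * (χ (p.1 : ZMod q) * (starRingEnd ℂ) (χ (p.2 : ZMod q)))) := by
      intro χ
      rw [tsum_mul_left]
      split_ifs <;> simp
    simp only [h2]
    rw [← Summable.tsum_finsetSum (fun χ _ => (hsum χ).mul_left _)]
    refine tsum_congr fun p => ?_
    unfold kern
    rw [Finset.mul_sum]
    refine Finset.sum_congr rfl fun χ _ => ?_
    ring
  rw [hL]
  set M : ℝ := ∑ d ∈ q.divisors.filter (fun d => 1 < d), (primitiveCharCount d : ℝ) / (d : ℝ) ^ b
    with hM
  set A : ℝ := ∑ d ∈ q.divisors.filter (fun d => 1 < d),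
              ((d : ℝ) ^ b)⁻¹ * ∑ l ∈ d.divisors, (l.totient : ℝ) with hA
  set B : ℝ := ∑ d ∈ q.divisors.filter (fun d => 1 < d),
              ((d : ℝ) ^ b)⁻¹ * ∑ l ∈ d.divisors, (l.totient : ℝ) / l with hB
  have hM0 : 0 ≤ M := Finset.sum_nonneg fun _ _ => by positivity
  have hMA : M ≤ A := by
    refine Finset.sum_le_sum fun d hd => ?_
    have hd0 : 0 < d := by
      have := (Finset.mem_filter.mp hd).2; omega
    rw [div_eq_mul_inv, mul_comm]
    gcongr
    exact primitiveCharCount_le d hd0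
  have hdiag := tsum_diag (q := q) hX M
  obtain ⟨hds, hdv⟩ := hdiag
  set ex : ℝ := X ^ (-(1 : ℝ) / 2) with hex
  have hex0 : 0 ≤ ex := by positivity
  -- off-diagonal
  have hoff := hasSum_off b q hX
  have hpt : ∀ p : ℕ × ℕ, ‖cwt X p * kern b q p - cwt X p * diagc q M p‖ ≤
      ∑ d ∈ q.divisors.filter (fun d => 1 < d), ((d : ℝ) ^ b)⁻¹ *
        ∑ l ∈ d.divisors, (l.totient : ℝ) * (wt X p * ind l p) := by
    intro p
    rw [← mul_sub, norm_mul]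
    calc _ ≤ wt X p * ∑ d ∈ q.divisors.filter (fun d => 1 < d), ((d : ℝ) ^ b)⁻¹ *
        ∑ l ∈ d.divisors, (l.totient : ℝ) * ind l p := by
          gcongr
          · exact wt_nonneg _ _
          · exact norm_cwt_le hX0 p
          · exact kern_sub_le b q p
      _ = _ := by
          simp only [Finset.mul_sum]
          refine Finset.sum_congr rfl fun d _ => Finset.sum_congr rfl fun l _ => ?_
          ring
  have hks : Summable (fun p : ℕ × ℕ => cwt X p * kern b q p - cwt X p * diagc q M p) :=
    Summable.of_norm_bounded hoff.summable hpt
  have hks2 : Summable (fun p : ℕ × ℕ => cwt X p * kern b q p) := by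
    simpa using hks.add hds
  have hN : ‖∑' p : ℕ × ℕ, (cwt X p * kern b q p - cwt X p * diagc q M p)‖ ≤
      800 * (ex * A + Real.log X ^ 2 * B) := by
    refine (tsum_of_norm_bounded hoff hpt).trans ?_
    rw [hA, hB, Finset.mul_sum, Finset.mul_sum, ← Finset.sum_add_distrib, Finset.mul_sum]
    refine Finset.sum_le_sum fun d hd => ?_
    have hd0 : (0 : ℝ) ≤ ((d : ℝ) ^ b)⁻¹ := by positivity
    have : ∑ l ∈ d.divisors, (l.totient : ℝ) * ∑' p, wt X p * ind l p ≤
        ∑ l ∈ d.divisors, (l.totient : ℝ) * (800 * (ex + Real.log X ^ 2 / l)) := by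
      refine Finset.sum_le_sum fun l hl => ?_
      gcongr
      exact offdiag_le' hX (Nat.pos_of_mem_divisors hl)
    refine (mul_le_mul_of_nonneg_left this hd0).trans (le_of_eq ?_)
    simp only [Finset.mul_sum, ← Finset.sum_add_distrib]
    refine Finset.sum_congr rfl fun l _ => ?_
    ring
  rw [hks2.tsum_sub hds, hdv] at hN
  set T : ℝ := ∑' n : ℕ, dcoef q n * Real.exp (-((n : ℝ) * n) / X)
  set D : ℝ := ∑' n : ℕ, dcoef q n
  have hdb : |T - D| ≤ 4 * ex := diag_bound q hX
  have hfin : ‖((M / 2 * T : ℝ) : ℂ) - ((D / 2 * M : ℝ) : ℂ)‖ ≤ 2 * (ex * A) := by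
    rw [← Complex.ofReal_sub, Complex.norm_real, Real.norm_eq_abs]
    have : M / 2 * T - D / 2 * M = M / 2 * (T - D) := by ring
    rw [this, abs_mul, abs_of_nonneg (by positivity)]
    calc M / 2 * |T - D| ≤ A / 2 * (4 * ex) := by gcongr
      _ = _ := by ring
  have hA0 : 0 ≤ ex * A := mul_nonneg hex0 (hM0.trans hMA)
  have hB0 : 0 ≤ Real.log X ^ 2 * B :=
    mul_nonneg (sq_nonneg _) (Finset.sum_nonneg fun _ _ => by positivity)
  refine (norm_sub_le_norm_sub_add_norm_sub _ ((M / 2 * T : ℝ) : ℂ) _).trans ?_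
  linarith
end

section
/- Let p be a prime and k a positive integer, and set q = p^k. Then, unconditionally, Σ_{χ ≠ χ0, χ(−1)=1} (f_χ · |L(1,χ)|^2)^{−1} = Σ_{χ even, non-quadratic} (f_χ · |L(1,χ)|^2)^{−1} + O(1) ≪ k^3 (log p)^2, with absolute implied constants; here the contribution of quadratic characters is O(1) and the whole sum is at most of order k^3 (log p)^2. -/
open Complex DirichletCharacter

/-- product over zeros -/
noncomputable def zprod (l : List ℂ) (s : ℂ) : ℂ := (l.map (fun ρ => 1 - s / ρ)).prod

lemma zprod_zero (l : List ℂ) : zprod l 0 = 1 := by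
  unfold zprod; induction l <;> simp_all

lemma zprod_deriv (l : List ℂ) : HasDerivAt (zprod l) (-(l.map (fun ρ => 1 / ρ)).sum) 0 := by
  induction l with
  | nil =>
    have e : zprod [] = fun _ => 1 := by ext s; simp [zprod]
    rw [e]; simpa using hasDerivAt_const (0:ℂ) (1:ℂ)
  | cons a t ih =>
    have h1 : HasDerivAt (fun s : ℂ => 1 - s / a) (-(1/a)) 0 := by
      simpa using ((hasDerivAt_id (0:ℂ)).div_const a).const_sub 1
    have := h1.mul ih
    have e : zprod (a :: t) = (fun s : ℂ => 1 - s / a) * zprod t := by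
      ext s; simp [zprod]
    rw [e]
    refine this.congr_deriv ?_
    simp only [zprod_zero, List.map_cons, List.sum_cons, zero_div]; ring

lemma zprod_big (l : List ℂ) (r : ℝ) (hl : ∀ ρ ∈ l, ρ ≠ 0 ∧ ‖ρ‖ ≤ r) (s : ℂ) (hs : ‖s‖ = 3 * r) :
    2 ^ l.length ≤ ‖zprod l s‖ := by
  induction l with
  | nil => simp [zprod]
  | cons a t ih =>
    have e : zprod (a :: t) s = (1 - s / a) * zprod t s := by simp [zprod]
    rw [e, norm_mul, List.length_cons, pow_succ']
    have ⟨h0, h1⟩ := hl a (by simp)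
    have : 2 ≤ ‖1 - s / a‖ := by
      have h2 : 3 ≤ ‖s / a‖ := by
        rw [norm_div, le_div_iff₀ (norm_pos_iff.mpr h0), hs]; linarith
      have := norm_sub_norm_le (s/a) 1
      rw [norm_sub_rev] at this
      rw [norm_one] at this; linarith
    have := ih (fun ρ hρ => hl ρ (by simp [hρ]))
    gcongr

lemma zprod_low (l : List ℂ) (δ : ℝ) (hδ : 0 < δ) (hl : ∀ ρ ∈ l, ρ.re ≤ -δ) :
    0 ≤ (l.map (fun ρ => -δ * (1/ρ).re)).sum ∧ 
    1 - (l.map (fun ρ => -δ * (1/ρ).re)).sum ≤ ‖zprod l (-δ)‖ ∧ ‖zprod l (-δ)‖ ≥ 0 := by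
  induction l with
  | nil => simp [zprod]
  | cons a t ih =>
    have e : zprod (a :: t) (-δ) = (1 - (-δ) / a) * zprod t (-δ) := by simp [zprod]
    obtain ⟨i1, i2, i3⟩ := ih (fun ρ hρ => hl ρ (by simp [hρ]))
    have ha := hl a (by simp)
    set x := -δ * (1/a).re with hx
    have hn : 0 < normSq a := by
      apply normSq_pos.mpr; rintro rfl; simp at ha; linarith
    have hx' : x = -δ * a.re / normSq a := by
      rw [hx]; simp [one_div, inv_re]; ring
    have hx0 : 0 ≤ x := by
      rw [hx']; apply div_nonneg _ hn.le; nlinarith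
    have hx1 : x ≤ 1 := by
      rw [hx', div_le_one hn, normSq_apply]; nlinarith [mul_self_nonneg a.im]
    have hre : 1 - x ≤ ‖1 - (-δ : ℂ) / a‖ := by
      refine le_trans (le_of_eq ?_) (re_le_norm _)
      rw [hx']; simp [div_re]
    set S := (t.map (fun ρ => -δ * (1/ρ).re)).sum
    refine ⟨?_, ?_, norm_nonneg _⟩
    · simp only [List.map_cons, List.sum_cons]; positivity
    · rw [e, norm_mul]; simp only [List.map_cons, List.sum_cons]
      change 1 - (x + S) ≤ _
      by_cases hS : S ≤ 1
      · calc 1 - (x + S) ≤ (1 - x) * (1 - S) := by nlinarith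
          _ ≤ _ := by gcongr
      · have : 0 ≤ ‖1 - (-δ : ℂ) / a‖ * ‖zprod t (-δ)‖ := by positivity
        linarith

lemma zprod_diff (l : List ℂ) : Differentiable ℂ (zprod l) := by
  induction l with
  | nil => unfold zprod; simp
  | cons a t ih =>
    have e : zprod (a :: t) = fun s => (1 - s / a) * zprod t s := by ext s; simp [zprod]
    rw [e]; fun_prop

/-- max modulus on a disc -/
lemma maxmod (h : ℂ → ℂ) (hh : Differentiable ℂ h) (R B : ℝ) (hR : 0 < R) (hB : ∀ s, ‖s‖ = R → ‖h s‖ ≤ B) :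
    ∀ s, ‖s‖ ≤ R → ‖h s‖ ≤ B := by
  intro s hs
  refine norm_le_of_forall_mem_frontier_norm_le (U := Metric.ball 0 R) Metric.isBounded_ball hh.diffContOnCl ?_ ?_
  · intro z hz; rw [frontier_ball _ hR.ne'] at hz; exact hB z (by simpa using hz)
  · rw [closure_ball _ hR.ne']; simpa using hs

/-- Factor out all the zeros in a disc. -/
lemma factor_zeros (f : ℂ → ℂ) (hf : Differentiable ℂ f) (r B : ℝ) (hr : 0 < r) (hf0 : f 0 ≠ 0)
    (hB : ∀ s, ‖s‖ = 3 * r → ‖f s‖ ≤ B) :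
    ∃ (l : List ℂ) (h : ℂ → ℂ), Differentiable ℂ h ∧ (∀ s, f s = zprod l s * h s) ∧
      (∀ ρ ∈ l, ρ ≠ 0 ∧ ‖ρ‖ ≤ r ∧ f ρ = 0) ∧ (∀ s, ‖s‖ ≤ r → h s ≠ 0) ∧
      (∀ s, ‖s‖ ≤ 3 * r → ‖h s‖ ≤ B) := by
  let P : ℕ → Prop := fun n => ∃ (l : List ℂ) (h : ℂ → ℂ), l.length = n ∧ Differentiable ℂ h ∧ 
    (∀ s, f s = zprod l s * h s) ∧ (∀ ρ ∈ l, ρ ≠ 0 ∧ ‖ρ‖ ≤ r ∧ f ρ = 0)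
  have hP0 : P 0 := ⟨[], f, rfl, hf, by simp [zprod], by simp⟩
  have hbd : ∀ (l : List ℂ) (h : ℂ → ℂ), Differentiable ℂ h → 
    (∀ s, f s = zprod l s * h s) → (∀ ρ ∈ l, ρ ≠ 0 ∧ ‖ρ‖ ≤ r ∧ f ρ = 0) → 
      ∀ s, ‖s‖ ≤ 3 * r → ‖h s‖ ≤ B / 2 ^ l.length := by
    intro l h hh hfac hl
    apply maxmod h hh _ _ (by positivity)
    intro s hs
    have h1 := hB s hs
    rw [hfac, norm_mul] at h1
    have h2 := zprod_big l r (fun ρ hρ => ⟨(hl ρ hρ).1, (hl ρ hρ).2.1⟩) s hs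
    rw [le_div_iff₀ (by positivity)]
    calc _ ≤ ‖h s‖ * ‖zprod l s‖ := by gcongr
      _ ≤ B := by linarith
  have hB0 : 0 ≤ B := by
    have := hbd [] f hf (by simp [zprod]) (by simp) 0 (by simp; positivity)
    simp at this; exact (norm_nonneg _).trans this
  have hbound : ∃ N, ∀ n, P n → n ≤ N := by
    obtain ⟨N, hN⟩ := pow_unbounded_of_one_lt (B / ‖f 0‖) (one_lt_two)
    refine ⟨N, ?_⟩
    rintro n ⟨l, h, rfl, hh, hfac, hl⟩
    have h1 := hbd l h hh hfac hl 0 (by simp; positivity)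
    have h2 : f 0 = h 0 := by rw [hfac, zprod_zero, one_mul]
    have h0 : 0 < ‖f 0‖ := norm_pos_iff.mpr hf0
    rw [← h2, le_div_iff₀ (by positivity), mul_comm, ← le_div_iff₀ h0] at h1
    have : (2:ℝ) ^ l.length < 2 ^ N := h1.trans_lt hN
    exact ((pow_lt_pow_iff_right₀ one_lt_two).mp this).le
  obtain ⟨N, hN⟩ := hbound
  classical
  have hspec := Nat.findGreatest_spec (P := P) (Nat.zero_le N) hP0
  have hmax := fun n => Nat.le_findGreatest (P := P) (n := N) (m := n)
  set n := Nat.findGreatest P N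
  obtain ⟨l, h, hlen, hh, hfac, hl⟩ := hspec
  refine ⟨l, h, hh, hfac, hl, ?_, ?_⟩
  · intro s hs h0
    have hs0 : s ≠ 0 := by
      rintro rfl; apply hf0; rw [hfac, h0, mul_zero]
    have hn : P (n+1) := by
      refine ⟨s :: l, fun z => -s * dslope h s z, by simp [hlen], ?_, ?_, ?_⟩
      · have : Differentiable ℂ (dslope h s) := by
          rw [← differentiableOn_univ] at hh ⊢
          exact (Complex.differentiableOn_dslope (by simp)).mpr hh
        exact this.const_mul _
      · intro z
        have e : zprod (s :: l) z = (1 - z / s) * zprod l z := by simp [zprod]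
        rw [hfac, e]
        have h3 := sub_smul_dslope h s z
        rw [h0, sub_zero, smul_eq_mul] at h3
        rw [← h3]; field_simp; ring
      · intro ρ hρ
        rcases List.mem_cons.mp hρ with rfl | hρ
        · exact ⟨hs0, hs, by rw [hfac, h0, mul_zero]⟩
        · exact hl ρ hρ
    have := hmax (n+1) (hN _ hn) hn
    omega
  · intro s hs
    refine (hbd l h hh hfac hl s hs).trans ?_
    exact div_le_self hB0 (one_le_pow₀ one_le_two)

/-- logarithm of a zero free function with Borel-Caratheodory -/
lemma log_bound (h : ℂ → ℂ) (hh : Differentiable ℂ h) (r M : ℝ) (hr : 0 < r) (hM : 0 < M)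
    (hz : ∀ s, ‖s‖ ≤ r → h s ≠ 0) (hB : ∀ s, ‖s‖ ≤ r → ‖h s‖ ≤ Real.exp M * ‖h 0‖) :
    ‖deriv h 0 / h 0‖ ≤ 2 * M / r ∧ 
    ∀ s, ‖s‖ < r → ‖h 0‖ * Real.exp (-(2 * M * ‖s‖ / (r - ‖s‖))) ≤ ‖h s‖ := by
  have hd : DifferentiableOn ℂ (fun z => deriv h z / h z) (Metric.ball 0 r) := by
    intro z hzz
    have : h z ≠ 0 := hz z (by simpa using (Metric.mem_ball.mp hzz).le)
    have h1 : DifferentiableAt ℂ (deriv h) z := (hh.analyticAt z).deriv.differentiableAt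
    exact (h1.div (hh z) this).differentiableWithinAt
  obtain ⟨k0, hk0⟩ := hd.isExactOn_ball
  let k := fun z => k0 z - k0 0
  have hk : ∀ z ∈ Metric.ball (0:ℂ) r, HasDerivAt k (deriv h z / h z) z := fun z hz => by
    exact (hk0 z hz).sub_const _
  have hk00 : k 0 = 0 := by simp [k]
  have hne : ∀ z ∈ Metric.ball (0:ℂ) r, h z ≠ 0 := fun z hzz => hz z (by simpa using (Metric.mem_ball.mp hzz).le)
  have hexp : ∀ z ∈ Metric.ball (0:ℂ) r, h z = h 0 * exp (k z) := by
    intro z hzz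
    have hder : ∀ w ∈ Metric.ball (0:ℂ) r, HasDerivAt (fun w => h w * exp (- k w)) 0 w := by
      intro w hw
      refine (((hh w).hasDerivAt).mul ((hk w hw).neg.cexp)).congr_deriv ?_
      have := hne w hw
      field_simp; ring
    have hc : (fun w => h w * exp (- k w)) z = (fun w => h w * exp (- k w)) 0 := by
      have hcv : Convex ℝ (Metric.ball (0:ℂ) r) := convex_ball _ _
      refine (Metric.isOpen_ball.is_const_of_deriv_eq_zero (𝕜 := ℂ) (f := fun w => h w * exp (- k w)) hcv.isPreconnected ?_ ?_ hzz (Metric.mem_ball_self hr))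
      · intro w hw; exact (hder w hw).differentiableAt.differentiableWithinAt
      · intro w hw; exact (hder w hw).deriv
    simp only [hk00, neg_zero, exp_zero, mul_one] at hc
    rw [← hc, mul_assoc, ← exp_add]; simp
  have h00 : 0 < ‖h 0‖ := norm_pos_iff.mpr (hz 0 (by simpa using hr.le))
  have hBC : ∀ z ∈ Metric.ball (0:ℂ) r, ‖k z‖ ≤ 2 * M * ‖z‖ / (r - ‖z‖) := by
    intro z hzz
    refine borelCaratheodory_zero hM (fun w hw => (hk w hw).differentiableAt.differentiableWithinAt) ?_ hr hzz hk00
    intro w hw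
    have h1 := hB w (by simpa using (Metric.mem_ball.mp hw).le)
    rw [hexp w hw, norm_mul, norm_exp, mul_comm] at h1
    have := le_of_mul_le_mul_right h1 h00
    exact Real.exp_le_exp.mp this
  constructor
  · have h1 := hk 0 (Metric.mem_ball_self hr)
    have h2 := (hasDerivAt_iff_tendsto_slope_zero.mp h1).norm
    have h3 : Filter.Tendsto (fun t : ℂ => 2 * M / (r - ‖t‖)) (nhdsWithin 0 {0}ᶜ) (nhds (2 * M / r)) := by
      have : ContinuousAt (fun t : ℂ => 2 * M / (r - ‖t‖)) 0 := by
        apply ContinuousAt.div <;> first | fun_prop | (simp; positivity)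
      have := this.tendsto
      simp at this
      exact this.mono_left nhdsWithin_le_nhds
    refine le_of_tendsto_of_tendsto h2 h3 ?_
    have : Metric.ball (0:ℂ) r ∈ nhdsWithin (0:ℂ) {0}ᶜ := mem_nhdsWithin_of_mem_nhds (Metric.ball_mem_nhds _ hr)
    filter_upwards [this, self_mem_nhdsWithin] with t ht ht0
    have ht0 : t ≠ 0 := ht0
    have := hBC t ht
    simp only [zero_add, hk00, sub_zero, smul_eq_mul, norm_mul, norm_inv]
    have h4 : 0 < ‖t‖ := norm_pos_iff.mpr ht0
    rw [inv_mul_le_iff₀ h4]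
    refine this.trans (le_of_eq ?_)
    ring
  · intro s hs
    have hs' : s ∈ Metric.ball (0:ℂ) r := by simpa using hs
    rw [hexp s hs', norm_mul, norm_exp]
    gcongr
    have := hBC s hs'
    have h5 := abs_re_le_norm (k s)
    have := neg_abs_le (k s).re
    linarith

/-- Local lemma of Landau. -/
lemma landau_local (f : ℂ → ℂ) (hf : Differentiable ℂ f) (r M δ : ℝ) (hr : 0 < r) (hM : 0 < M) (hδ : 0 < δ)
    (hδr : 2 * δ ≤ r) (hf0 : f 0 ≠ 0) (hB : ∀ s, ‖s‖ = 3 * r → ‖f s‖ ≤ Real.exp M * ‖f 0‖)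
    (hz : ∀ s, f s = 0 → s.re ≤ -δ) :
    -(deriv f 0 / f 0).re ≤ 2 * M / r ∧
    ‖f 0‖ * Real.exp (-(4 * M * δ / r)) * (1 - δ * (deriv f 0 / f 0).re - 2 * M * δ / r) ≤ ‖f (-δ)‖ := by
  obtain ⟨l, h, hh, hfac, hl, hne, hhB⟩ := factor_zeros f hf r _ hr hf0 hB
  have hfh : f 0 = h 0 := by rw [hfac, zprod_zero, one_mul]
  obtain ⟨b1, b2⟩ := log_bound h hh r M hr hM hne (fun s hs => hfh ▸ hhB s (by linarith))
  have hlow := zprod_low l δ hδ (fun ρ hρ => hz ρ (hl ρ hρ).2.2)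
  have hder : deriv f 0 = -(l.map (fun ρ => 1 / ρ)).sum * h 0 + deriv h 0 := by
    have : f = zprod l * h := by ext s; exact hfac s
    rw [this]
    have := ((zprod_deriv l).mul (hh 0).hasDerivAt).deriv
    rw [this, zprod_zero, one_mul]
  have hh0 : h 0 ≠ 0 := hfh ▸ hf0
  have hld : deriv f 0 / f 0 = -(l.map (fun ρ => 1 / ρ)).sum + deriv h 0 / h 0 := by
    rw [hder, hfh]; field_simp
  set S := (l.map (fun ρ => -δ * (1/ρ).re)).sum with hS
  have hSe : S = δ * (-(l.map (fun ρ => 1 / ρ)).sum).re := by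
    rw [hS]; clear * -
    induction l with
    | nil => simp
    | cons a t ih => simp only [List.map_cons, List.sum_cons, neg_add, add_re, mul_add, ← ih]; simp
  have hre : δ * (deriv f 0 / f 0).re = S + δ * (deriv h 0 / h 0).re := by
    rw [hld, add_re, mul_add, hSe]
  have hhre := (abs_le.mp ((abs_re_le_norm (deriv h 0 / h 0)).trans b1))
  constructor
  · have : 0 ≤ δ * (-(l.map (fun ρ => 1 / ρ)).sum).re := hSe ▸ hlow.1
    have := nonneg_of_mul_nonneg_right this hδ
    rw [hld, add_re]; linarith [hhre.1]
  · rw [hfac (-δ), norm_mul, hfh]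
    have hs : ‖(-δ:ℂ)‖ = δ := by simp [abs_of_pos hδ]
    have h2 := b2 (-δ) (by rw [hs]; linarith)
    rw [hs] at h2
    have h3 : 2 * M * δ / (r - δ) ≤ 4 * M * δ / r := by
      rw [div_le_div_iff₀ (by linarith) hr]; nlinarith [mul_pos hM hδ]
    have h4 : ‖h 0‖ * Real.exp (-(4 * M * δ / r)) ≤ ‖h (-δ)‖ := by
      refine le_trans ?_ h2; gcongr
    have h5 : 1 - δ * (deriv f 0 / h 0).re - 2 * M * δ / r ≤ 1 - S := by
      rw [← hfh, hre]
      have : -(2 * M / r) * δ ≤ (deriv h 0 / h 0).re * δ := by gcongr; exact hhre.1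
      have e : 2 * M * δ / r = 2 * M / r * δ := by ring
      rw [e]; linarith
    calc _ ≤ ‖h 0‖ * Real.exp (-(4 * M * δ / r)) * ‖zprod l (-δ)‖ := by
          gcongr; linarith [hlow.2.1]
      _ ≤ ‖h (-δ)‖ * ‖zprod l (-δ)‖ := by gcongr
      _ = _ := mul_comm _ _


/-- partial sums of a character -/
noncomputable def cpart {q : ℕ} (χ : DirichletCharacter ℂ q) (n : ℕ) : ℂ :=
  ∑ i ∈ Finset.range n, χ ((i + 1 : ℕ) : ZMod q)

lemma cpart_succ {q : ℕ} (χ : DirichletCharacter ℂ q) (n : ℕ) :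
    cpart χ (n+1) = cpart χ n + χ ((n + 1 : ℕ) : ZMod q) := Finset.sum_range_succ _ _

lemma cpart_period {q : ℕ} [NeZero q] (χ : DirichletCharacter ℂ q) (hχ : χ ≠ 1) (n : ℕ) :
    cpart χ (n + q) = cpart χ n := by
  induction n with
  | zero =>
    have h0 : cpart χ 0 = 0 := by simp [cpart]
    rw [h0, zero_add]
    have h1 : cpart χ q = ∑ i ∈ Finset.range q, χ (i : ZMod q) := by
      have a := Finset.sum_range_succ (fun i : ℕ => χ (i : ZMod q)) q
      have b := Finset.sum_range_succ' (fun i : ℕ => χ (i : ZMod q)) q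
      rw [a] at b
      rw [ZMod.natCast_self, Nat.cast_zero] at b
      exact (add_right_cancel b).symm
    rw [h1, ← MulChar.sum_eq_zero_of_ne_one hχ]
    refine Finset.sum_bij' (fun i _ => (i : ZMod q)) (fun x _ => x.val) ?_ ?_ ?_ ?_ ?_
    · simp
    · intro x _; simpa using ZMod.val_lt x
    · intro i hi; exact ZMod.val_natCast_of_lt (by simpa using hi)
    · intro x _; simp
    · simp
  | succ n ih =>
    rw [show n + 1 + q = n + q + 1 by ring, cpart_succ, cpart_succ, ih]
    congr 2
    push_cast; simp

lemma cpart_norm {q : ℕ} [NeZero q] (χ : DirichletCharacter ℂ q) (hχ : χ ≠ 1) (n : ℕ) :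
    ‖cpart χ n‖ ≤ q := by
  induction n using Nat.strong_induction_on with
  | _ n ih =>
    by_cases h : n < q
    · calc ‖cpart χ n‖ ≤ ∑ i ∈ Finset.range n, 1 := norm_sum_le_of_le _ (fun i _ => χ.norm_le_one _)
        _ = n := by simp
        _ ≤ q := by exact_mod_cast h.le
    · have hq := NeZero.pos q
      have := ih (n - q) (by omega)
      rwa [← cpart_period χ hχ, Nat.sub_add_cancel (by omega)] at this

lemma cpow_diff (n : ℕ) (s : ℂ) (hs : 0 < s.re) :
    ‖((n + 1 : ℕ) : ℂ) ^ (-s) - ((n + 2 : ℕ) : ℂ) ^ (-s)‖ ≤ ‖s‖ * ((n + 1 : ℕ) : ℝ) ^ (-s.re - 1) := by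
  have h := norm_image_sub_le_of_norm_deriv_le_segment' (a := ((n+1:ℕ):ℝ)) (b := ((n+2:ℕ):ℝ))
    (f := fun x : ℝ => (x:ℂ) ^ (-s)) (f' := fun x : ℝ => -s * (x:ℂ) ^ (-s - 1))
    (C := ‖s‖ * ((n + 1 : ℕ) : ℝ) ^ (-s.re - 1)) ?_ ?_ ((n+2:ℕ):ℝ) ?_
  · rw [norm_sub_rev]
    refine h.trans (le_of_eq ?_)
    push_cast; ring
  · intro x hx
    have hx0 : 0 < x := lt_of_lt_of_le (by positivity) hx.1
    have hs0 : -s ≠ 0 := by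
      intro h; rw [neg_eq_zero] at h; rw [h] at hs; simp at hs
    have := hasDerivAt_ofReal_cpow_const' (x := x) hx0.ne' (r := -s - 1) (by
      intro h; apply hs0; linear_combination h)
    rw [show -s - 1 + 1 = -s by ring] at this
    have h2 := this.const_mul (-s)
    have h3 : (fun y : ℝ => -s * ((y:ℂ) ^ (-s) / -s)) = fun y : ℝ => (y:ℂ) ^ (-s) := by
      ext y; exact mul_div_cancel₀ _ hs0
    rw [h3] at h2
    exact h2.hasDerivWithinAt
  · intro x hx
    have hx0 : 0 < x := lt_of_lt_of_le (by positivity) hx.1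
    rw [norm_mul, norm_neg, norm_cpow_eq_rpow_re_of_pos hx0]
    simp only [sub_re, neg_re, one_re]
    gcongr ?_ * ?_
    exact Real.rpow_le_rpow_of_nonpos (by positivity) hx.1 (by linarith)
  · simp

/-- Abel-summed L-series term -/
noncomputable def aterm {q : ℕ} (χ : DirichletCharacter ℂ q) (n : ℕ) (s : ℂ) : ℂ :=
  cpart χ (n+1) * (((n + 1 : ℕ) : ℂ) ^ (-s) - ((n + 2 : ℕ) : ℂ) ^ (-s))

lemma aterm_norm {q : ℕ} [NeZero q] (χ : DirichletCharacter ℂ q) (hχ : χ ≠ 1) (n : ℕ) (s : ℂ) (σ : ℝ) (hσ : 0 < σ)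
    (hs : σ ≤ s.re) : ‖aterm χ n s‖ ≤ q * ‖s‖ * ((n + 1 : ℕ) : ℝ) ^ (-σ - 1) := by
  rw [aterm, norm_mul, mul_assoc]
  gcongr
  · exact cpart_norm χ hχ _
  · refine (cpow_diff n s (by linarith)).trans ?_
    gcongr
    · simp

lemma summ_rpow (σ : ℝ) (hσ : 0 < σ) : Summable (fun n : ℕ => ((n + 1 : ℕ) : ℝ) ^ (-σ - 1)) := by
  have := (Real.summable_nat_rpow (p := -σ - 1)).mpr (by linarith)
  exact (summable_nat_add_iff 1).mpr this

lemma aterm_partial {q : ℕ} (χ : DirichletCharacter ℂ q) (s : ℂ) (N : ℕ) :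
    ∑ n ∈ Finset.range N, aterm χ n s = 
      ∑ n ∈ Finset.range N, χ ((n + 1 : ℕ) : ZMod q) * ((n + 1 : ℕ) : ℂ) ^ (-s) - cpart χ N * ((N + 1 : ℕ) : ℂ) ^ (-s) := by
  induction N with
  | zero => simp [cpart]
  | succ N ih =>
    rw [Finset.sum_range_succ, Finset.sum_range_succ, ih, aterm, cpart_succ]
    ring_nf

lemma tendsto_bdry {q : ℕ} [NeZero q] (χ : DirichletCharacter ℂ q) (hχ : χ ≠ 1) (s : ℂ) (hs : 0 < s.re) :
    Filter.Tendsto (fun N : ℕ => cpart χ N * ((N + 1 : ℕ) : ℂ) ^ (-s)) Filter.atTop (nhds 0) := by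
  apply squeeze_zero_norm (a := fun N : ℕ => (q:ℝ) * ((N+1 : ℕ) : ℝ) ^ (-s.re))
  · intro N
    rw [norm_mul]
    gcongr
    · exact cpart_norm χ hχ _
    · rw [norm_natCast_cpow_of_pos (by omega)]; simp
  · have h1 := (tendsto_rpow_neg_atTop hs).comp (tendsto_natCast_atTop_atTop (R := ℝ))
    have h2 := (Filter.tendsto_add_atTop_iff_nat 1).mpr h1
    have h3 := h2.const_mul (q:ℝ)
    simpa using h3

lemma aterm_tendsto {q : ℕ} [NeZero q] (χ : DirichletCharacter ℂ q) (hχ : χ ≠ 1) (s : ℂ) (hs : 0 < s.re) :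
    Filter.Tendsto (fun N : ℕ => ∑ n ∈ Finset.range N, χ ((n + 1 : ℕ) : ZMod q) * ((n + 1 : ℕ) : ℂ) ^ (-s))
      Filter.atTop (nhds (∑' n, aterm χ n s)) := by
  have hsum : Summable (fun n => aterm χ n s) := by
    refine Summable.of_norm_bounded ((summ_rpow s.re hs).mul_left (q * ‖s‖)) (fun n => ?_)
    exact aterm_norm χ hχ n s s.re hs le_rfl
  have h1 := hsum.hasSum.tendsto_sum_nat
  have h2 := h1.add (tendsto_bdry χ hχ s hs)
  rw [add_zero] at h2
  refine h2.congr (fun N => ?_)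
  rw [aterm_partial]; ring

lemma L_eq_aterm_one {q : ℕ} [NeZero q] (χ : DirichletCharacter ℂ q) (hχ : χ ≠ 1) (s : ℂ) (hs : 1 < s.re) :
    χ.LFunction s = ∑' n, aterm χ n s := by
  rw [LFunction_eq_LSeries χ hs]
  have h1 := (LSeriesSummable_of_one_lt_re χ hs).hasSum.tendsto_sum_nat
  have h2 := (Filter.tendsto_add_atTop_iff_nat 1).mpr h1
  refine tendsto_nhds_unique h2 ((aterm_tendsto χ hχ s (by linarith)).congr (fun N => ?_))
  rw [Finset.sum_range_succ']
  simp only [LSeries.term_zero, add_zero]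
  refine Finset.sum_congr rfl (fun n _ => ?_)
  rw [LSeries.term_of_ne_zero (by omega), cpow_neg, div_eq_mul_inv]

lemma L_eq_aterm {q : ℕ} [NeZero q] (χ : DirichletCharacter ℂ q) (hχ : χ ≠ 1) (s : ℂ) (hs : 1/4 < s.re) (hs' : ‖s‖ < 10) :
    χ.LFunction s = ∑' n, aterm χ n s := by
  set U : Set ℂ := {s | 1/4 < s.re} ∩ Metric.ball 0 10 with hU
  have hUo : IsOpen U := (isOpen_lt continuous_const continuous_re).inter Metric.isOpen_ball
  have hUc : Convex ℝ U := (convex_halfSpace_re_gt _).inter (convex_ball _ _)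
  have hG : DifferentiableOn ℂ (fun s => ∑' n, aterm χ n s) U := by
    refine differentiableOn_tsum_of_summable_norm (u := fun n : ℕ => q * 10 * ((n + 1 : ℕ) : ℝ) ^ (-(1/4:ℝ) - 1)) 
      ((summ_rpow (1/4) (by norm_num)).mul_left _) ?_ hUo ?_
    · intro n
      unfold aterm
      have h1 : ((n + 1 : ℕ) : ℂ) ≠ 0 := by exact_mod_cast (by omega : n + 1 ≠ 0)
      have h2 : ((n + 2 : ℕ) : ℂ) ≠ 0 := by exact_mod_cast (by omega : n + 2 ≠ 0)
      refine Differentiable.differentiableOn ?_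
      refine Differentiable.const_mul (Differentiable.sub ?_ ?_) _
      · exact differentiable_neg.const_cpow (Or.inl h1)
      · exact differentiable_neg.const_cpow (Or.inl h2)
    · intro n w hw
      refine (aterm_norm χ hχ n w (1/4) (by norm_num) hw.1.le).trans ?_
      gcongr
      have := hw.2; simp at this; exact this.le
  have h := AnalyticOnNhd.eqOn_of_preconnected_of_eventuallyEq (U := U) (f := χ.LFunction) (g := fun s => ∑' n, aterm χ n s) (z₀ := 2)
    ((differentiable_LFunction hχ).differentiableOn.analyticOnNhd hUo) (hG.analyticOnNhd hUo) hUc.isPreconnected ?_ ?_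
  · exact h ⟨hs, by simpa using hs'⟩
  · constructor
    · simp; norm_num
    · simp; norm_num
  · have : {s : ℂ | 1 < s.re} ∈ nhds (2:ℂ) := (isOpen_lt continuous_const continuous_re).mem_nhds (by simp)
    filter_upwards [this] with s hs
    exact L_eq_aterm_one χ hχ s hs

lemma L_upper : ∃ K : ℝ, 1 ≤ K ∧ ∀ (q : ℕ) [NeZero q] (χ : DirichletCharacter ℂ q), χ ≠ 1 → ∀ s : ℂ, 1/2 ≤ s.re → ‖s‖ ≤ 2 →
    ‖χ.LFunction s‖ ≤ K * q := by
  refine ⟨max 1 (2 * ∑' n : ℕ, ((n + 1 : ℕ) : ℝ) ^ (-(1/2:ℝ) - 1)), le_max_left _ _, ?_⟩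
  intro q _ χ hχ s hs hs2
  rw [L_eq_aterm χ hχ s (by linarith) (by linarith)]
  have h1 := tsum_of_norm_bounded ((summ_rpow (1/2) (by norm_num)).hasSum.mul_left (q * ‖s‖)) 
    (fun n => aterm_norm χ hχ n s (1/2) (by norm_num) hs)
  refine h1.trans ?_
  have h2 : 0 ≤ ∑' n : ℕ, ((n + 1 : ℕ) : ℝ) ^ (-(1/2:ℝ) - 1) := tsum_nonneg (fun n => by positivity)
  calc _ ≤ q * 2 * ∑' n : ℕ, ((n + 1 : ℕ) : ℝ) ^ (-(1/2:ℝ) - 1) := by gcongr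
    _ = (2 * ∑' n : ℕ, ((n + 1 : ℕ) : ℝ) ^ (-(1/2:ℝ) - 1)) * q := by ring
    _ ≤ _ := by gcongr; exact le_max_right _ _

section Notations
open scoped LSeries.notation ArithmeticFunction.vonMangoldt ArithmeticFunction.Moebius

/-- zeta near one -/
lemma zeta_near : ∃ dl₀ > (0:ℝ), ∀ dl : ℝ, 0 < dl → dl ≤ dl₀ → 
    ‖riemannZeta (1 + dl)‖ ≤ 2 / dl ∧ (LSeries ↗Λ (1 + dl)).re ≤ 6 / 5 / dl := by
  have hcont : Continuous (LFunctionTrivChar₁ 1) := (differentiable_LFunctionTrivChar₁ 1).continuous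
  have h1 : LFunctionTrivChar₁ 1 1 = 1 := by simp
  have hc2 : ContinuousAt (fun s ↦ -deriv (LFunctionTrivChar₁ 1) s / LFunctionTrivChar₁ 1 s) 1 := by
    apply ContinuousAt.div
    · exact (((differentiable_LFunctionTrivChar₁ 1).contDiff (n := 1)).continuous_deriv le_rfl).neg.continuousAt
    · exact hcont.continuousAt
    · rw [h1]; exact one_ne_zero
  set g := (fun s ↦ -deriv (LFunctionTrivChar₁ 1) s / LFunctionTrivChar₁ 1 s) with hg
  have e1 : ∀ᶠ s in nhds (1:ℂ), ‖LFunctionTrivChar₁ 1 s‖ < 2 := by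
    apply hcont.norm.continuousAt.eventually_lt_const
    change ‖LFunctionTrivChar₁ 1 1‖ < 2
    rw [h1]; norm_num
  have e2 : ∀ᶠ s in nhds (1:ℂ), ‖g s‖ < ‖g 1‖ + 1 := by
    apply hc2.norm.eventually_lt_const
    linarith
  obtain ⟨ε, hε, H⟩ := Metric.eventually_nhds_iff.mp (e1.and e2)
  refine ⟨min (ε / 2) (1 / 5 / (‖g 1‖ + 1)), by positivity, ?_⟩
  intro dl hdl hdl0
  have hd1 : dl < ε := by linarith [hdl0.trans (min_le_left _ _)]
  have hd2 : dl * (‖g 1‖ + 1) ≤ 1 / 5 := by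
    rw [← le_div_iff₀ (by positivity)]; exact hdl0.trans (min_le_right _ _)
  have hne : (1 + dl : ℂ) ≠ 1 := by simp [hdl.ne']
  have hre : 1 < (1 + dl : ℂ).re := by simp [hdl]
  have hz : LFunctionTrivChar 1 = riemannZeta := by
    exact LFunction_modOne_eq
  obtain ⟨a, b⟩ := H (y := 1 + dl) (by simp [abs_of_pos hdl, hd1])
  have hL : LFunctionTrivChar₁ 1 (1 + dl) = dl * riemannZeta (1 + dl) := by
    rw [LFunctionTrivChar₁, Function.update_of_ne hne, hz]; ring
  constructor
  · rw [hL, norm_mul] at a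
    simp only [norm_real, Real.norm_eq_abs, abs_of_pos hdl] at a
    rw [le_div_iff₀ hdl]; linarith
  · rw [ArithmeticFunction.LSeries_vonMangoldt_eq_deriv_riemannZeta_div hre]
    have hzne : riemannZeta (1 + dl) ≠ 0 := riemannZeta_ne_zero_of_one_le_re (by simp [hdl.le])
    have hgd : - deriv riemannZeta (1 + dl) / riemannZeta (1 + dl) = g (1 + dl) + ((1 / dl : ℝ) : ℂ) := by
      simp only [hg]
      rw [deriv_LFunctionTrivChar₁_apply_of_ne_one 1 hne, hL, hz]
      have : (dl : ℂ) ≠ 0 := by exact_mod_cast hdl.ne'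
      push_cast
      field_simp; ring
    rw [hgd, add_re, ofReal_re]
    have := re_le_norm (g (1 + dl))
    have h3 : ‖g 1‖ + 1 ≤ 1 / 5 / dl := by rw [le_div_iff₀ hdl]; linarith
    have h4 : 6 / 5 / dl = 1 / 5 / dl + 1 / dl := by ring
    linarith

lemma L_lower_right {q : ℕ} [NeZero q] (χ : DirichletCharacter ℂ q) (dl : ℝ) (hdl : 0 < dl)  :
    1 ≤ ‖χ.LFunction (1 + dl)‖ * ‖riemannZeta (1 + dl)‖ := by
  have hre : 1 < (1 + dl : ℂ).re := by simp [hdl]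
  have h1 := DirichletCharacter.LSeries.mul_mu_eq_one χ hre
  rw [← LFunction_eq_LSeries χ hre] at h1
  have h2 : ‖LSeries (↗χ * ↗μ) (1 + dl)‖ ≤ ‖riemannZeta (1 + dl)‖ := by
    have hsum : Summable (fun n : ℕ => LSeries.term 1 (1 + dl) n) := (LSeriesSummable_one_iff.mpr hre)
    have ht : ∀ n : ℕ, LSeries.term 1 (1 + dl) n = ((‖LSeries.term 1 (1 + dl) n‖ : ℝ) : ℂ) := by
      intro n
      rcases eq_or_ne n 0 with rfl | hn
      · simp
      · rw [LSeries.term_of_ne_zero hn]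
        have : (n:ℂ) ^ (1 + dl : ℂ) = (((n:ℝ) ^ (1 + dl : ℝ) : ℝ) : ℂ) := by
          rw [ofReal_cpow (by positivity)]; push_cast; rfl
        rw [this]
        simp [abs_of_nonneg (Real.rpow_nonneg (Nat.cast_nonneg n) (1+dl))]
    have hz : riemannZeta (1 + dl) = ((∑' n, ‖LSeries.term 1 (1 + dl) n‖ : ℝ) : ℂ) := by
      rw [← LSeries_one_eq_riemannZeta hre, LSeries, ofReal_tsum]
      exact tsum_congr ht
    rw [hz, norm_real, Real.norm_eq_abs, abs_of_nonneg (tsum_nonneg (fun n => norm_nonneg _))]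
    refine tsum_of_norm_bounded hsum.norm.hasSum (fun n => ?_)
    apply LSeries.norm_term_le
    simp only [Pi.mul_apply, norm_mul, Pi.one_apply, norm_one]
    have a := χ.norm_le_one (n : ZMod q)
    have b : ‖((μ n : ℤ) : ℂ)‖ ≤ 1 := by
      rw [Complex.norm_intCast]; exact_mod_cast ArithmeticFunction.abs_moebius_le_one
    nlinarith [norm_nonneg (χ (n : ZMod q)), norm_nonneg ((μ n : ℤ) : ℂ)]
  have h3 : ‖χ.LFunction (1 + dl)‖ * ‖LSeries (↗χ * ↗μ) (1 + dl)‖ = 1 := by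
    rw [← norm_mul, h1, norm_one]
  rw [← h3]; gcongr

lemma three_four_one {q : ℕ} [NeZero q] (χ : DirichletCharacter ℂ q) (dl : ℝ) (hdl : 0 < dl)  :
    4 * (deriv χ.LFunction (1 + dl) / χ.LFunction (1 + dl)).re + (deriv (χ^2).LFunction (1 + dl) / (χ^2).LFunction (1 + dl)).re
      ≤ 3 * (LSeries ↗Λ (1 + dl)).re := by
  have hre : 1 < (1 + dl : ℂ).re := by simp [hdl]
  have key : ∀ ψ : DirichletCharacter ℂ q, deriv ψ.LFunction (1 + dl) / ψ.LFunction (1 + dl) = - LSeries (↗ψ * ↗Λ) (1 + dl) := by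
    intro ψ
    rw [DirichletCharacter.LSeries_twist_vonMangoldt_eq ψ hre, LFunction_eq_LSeries ψ hre, deriv_LFunction_eq_deriv_LSeries ψ hre]
    ring
  rw [key, key]
  have s0 : Summable (fun n => (LSeries.term ↗Λ (1 + dl) n)) := ArithmeticFunction.LSeriesSummable_vonMangoldt hre
  have s1 : Summable (fun n => (LSeries.term (↗χ * ↗Λ) (1 + dl) n)) := DirichletCharacter.LSeriesSummable_twist_vonMangoldt χ hre
  have s2 : Summable (fun n => (LSeries.term (↗(χ^2) * ↗Λ) (1 + dl) n)) := DirichletCharacter.LSeriesSummable_twist_vonMangoldt (χ^2) hre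
  have H := (((hasSum_re s0.hasSum).mul_left 3).add ((hasSum_re s1.hasSum).mul_left 4)).add (hasSum_re s2.hasSum)
  have := H.nonneg ?_
  · simp only [LSeries, neg_re]; linarith
  · intro n
    rcases eq_or_ne n 0 with rfl | hn
    · simp
    · simp only [LSeries.term_of_ne_zero hn, Pi.mul_apply]
      have : (n:ℂ) ^ (1 + dl : ℂ) = (((n:ℝ) ^ (1 + dl : ℝ) : ℝ) : ℂ) := by
        rw [ofReal_cpow (by positivity)]; push_cast; rfl
      rw [this]
      have hpos : 0 < (n:ℝ) ^ (1 + dl : ℝ) := Real.rpow_pos_of_pos (by positivity) _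
      simp only [div_ofReal_re, mul_re, ofReal_re, ofReal_im, mul_zero, sub_zero]
      have hΛ : 0 ≤ Λ n := ArithmeticFunction.vonMangoldt_nonneg
      have hpow : (χ ^ 2) (n : ZMod q) = χ n ^ 2 := MulChar.pow_apply' _ two_ne_zero _
      rw [hpow]
      set z := χ (n : ZMod q)
      have hz : 0 ≤ 3 + 4 * z.re + (z^2).re := by
        have hn : ‖z‖ ≤ 1 := χ.norm_le_one _
        have : z.re^2 + z.im^2 ≤ 1 := by
          have := normSq_eq_norm_sq z
          rw [normSq_apply] at this
          nlinarith [norm_nonneg z]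
        have e : (z^2).re = z.re^2 - z.im^2 := by rw [sq, mul_re]; ring
        rw [e]; nlinarith [sq_nonneg (1 + z.re)]
      have : 3 * (Λ n / (n:ℝ) ^ (1 + dl : ℝ)) + 4 * (z.re * Λ n / (n:ℝ) ^ (1 + dl : ℝ)) + (z^2).re * Λ n / (n:ℝ) ^ (1 + dl : ℝ) 
        = (3 + 4 * z.re + (z^2).re) * (Λ n / (n:ℝ) ^ (1 + dl : ℝ)) := by ring
      rw [this]; positivity

lemma three_le_of_ne_one {q : ℕ} [NeZero q] (χ : DirichletCharacter ℂ q) (hχ : χ ≠ 1) : 3 ≤ q := by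
  by_contra h
  have hq := NeZero.pos q
  apply hχ
  have : q = 1 ∨ q = 2 := by omega
  rcases this with rfl | rfl
  · exact level_one χ
  · ext a
    have : ∀ a : (ZMod 2)ˣ, a = 1 := by decide
    rw [this a]; simp

theorem L_one_lower : ∃ c > (0:ℝ), ∀ (q : ℕ) [NeZero q] (χ : DirichletCharacter ℂ q), χ ^ 2 ≠ 1 → 
    c / Real.log q ≤ ‖χ.LFunction 1‖ := by
  obtain ⟨K, hK, hL⟩ := L_upper
  obtain ⟨dl₀, hdl₀, hζ⟩ := zeta_near
  have hc : ∃ c₀ > (0:ℝ), c₀ ≤ dl₀ ∧ c₀ ≤ 1/12 ∧ c₀ * (2 + Real.log (2 * K / c₀)) ≤ 1/300 := by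
    have hcont : Continuous (fun x : ℝ => x * (2 + Real.log (2 * K)) - x * Real.log x) := by
      exact (continuous_id.mul continuous_const).sub Real.continuous_mul_log
    have e1 : ∀ᶠ x in nhds (0:ℝ), x * (2 + Real.log (2 * K)) - x * Real.log x < 1/300 :=
      hcont.continuousAt.eventually_lt_const (by simp)
    obtain ⟨ε, hε, H⟩ := Metric.eventually_nhds_iff.mp e1
    set c₀ := min (ε/2) (min dl₀ (1/12)) with hc0
    have hpos : 0 < c₀ := by positivity
    refine ⟨c₀, hpos, (min_le_right _ _).trans (min_le_left _ _), (min_le_right _ _).trans (min_le_right _ _), ?_⟩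
    have h1 : c₀ < ε := (min_le_left _ _).trans_lt (by linarith)
    have := H (y := c₀) (by simp [abs_of_pos hpos, h1])
    rw [Real.log_div (by positivity) hpos.ne']
    linarith
  obtain ⟨c₀, hc₀, hc1, hc2, hc3⟩ := hc
  refine ⟨c₀ / 80, by positivity, ?_⟩
  intro q _ χ hχ2
  have hχ : χ ≠ 1 := by rintro rfl; simp at hχ2
  have hq3 := three_le_of_ne_one χ hχ
  have hq3' : (3:ℝ) ≤ q := by exact_mod_cast hq3
  set l := Real.log q with hl
  have hl1 : 1 ≤ l := by
    rw [hl, Real.le_log_iff_exp_le (by linarith)]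
    linarith [Real.exp_one_lt_d9]
  set dl := c₀ / l with hdl
  have hdlpos : 0 < dl := by positivity
  have hdlc : dl ≤ c₀ := div_le_self hc₀.le hl1
  set M := l * (2 + Real.log (2 * K / c₀)) with hM
  have hlog0 : 0 ≤ Real.log (2 * K / c₀) := by
    apply Real.log_nonneg; rw [le_div_iff₀ hc₀]; linarith
  have hMpos : 0 < M := by positivity
  have hMdl : M * dl ≤ 1/300 := by
    have : M * dl = c₀ * (2 + Real.log (2 * K / c₀)) := by rw [hM, hdl]; field_simp
    rw [this]; exact hc3
  obtain ⟨hz1, hz2⟩ := hζ dl hdlpos (hdlc.trans hc1)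
  -- apply Landau to both characters
  have hexpM : K * q ≤ Real.exp M * (dl / 2) := by
    have h1 : q * q * (2 * K / c₀) ≤ Real.exp M := by
      have : Real.exp M = Real.exp (l + l) * Real.exp (l * Real.log (2 * K / c₀)) := by
        rw [← Real.exp_add, hM]; ring_nf
      rw [this, Real.exp_add, hl, Real.exp_log (by linarith)]
      gcongr
      calc 2 * K / c₀ = Real.exp (Real.log (2 * K / c₀)) := (Real.exp_log (by positivity)).symm
        _ ≤ _ := by
          apply Real.exp_le_exp.mpr
          exact le_mul_of_one_le_left hlog0 hl1
    have h2 : l ≤ q := (Real.log_le_sub_one_of_pos (by linarith)).trans (by linarith)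
    calc K * q = (q * l * (2 * K / c₀)) * (dl / 2) := by rw [hdl]; field_simp
      _ ≤ (q * q * (2 * K / c₀)) * (dl / 2) := by gcongr
      _ ≤ _ := by gcongr
  have main : ∀ ψ : DirichletCharacter ℂ q, ψ ≠ 1 → 
    dl / 2 ≤ ‖ψ.LFunction (1 + dl)‖ ∧ 
    -(deriv ψ.LFunction (1 + dl) / ψ.LFunction (1 + dl)).re ≤ 12 * M ∧
    ‖ψ.LFunction (1 + dl)‖ * Real.exp (-(24 * (M * dl))) * (1 - dl * (deriv ψ.LFunction (1 + dl) / ψ.LFunction (1 + dl)).re - 12 * (M * dl)) ≤ ‖ψ.LFunction 1‖ := by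
    intro ψ hψ
    have hlow : dl / 2 ≤ ‖ψ.LFunction (1 + dl)‖ := by
      have h1 := L_lower_right ψ dl hdlpos
      have h2 : 1 ≤ ‖ψ.LFunction (1 + dl)‖ * (2 / dl) := h1.trans (by gcongr)
      rw [← div_le_iff₀ (by positivity)] at h2
      simpa using h2
    have hd := differentiable_LFunction hψ
    have hl := landau_local (fun s => ψ.LFunction ((1 + dl) + s)) (hd.comp (differentiable_id.const_add _)) (1/6) M dl (by norm_num) hMpos hdlpos
      (by linarith) (by
        simp only [add_zero]
        exact norm_pos_iff.mp (lt_of_lt_of_le (by positivity) hlow)) ?_ ?_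
    · rw [deriv_comp_const_add] at hl
      simp only [add_zero] at hl
      refine ⟨hlow, ?_, ?_⟩
      · refine hl.1.trans (le_of_eq ?_); ring
      · have h2 := hl.2
        rw [show (1 + dl + -dl : ℂ) = 1 by ring] at h2
        refine le_trans (le_of_eq ?_) h2
        congr 2
        · congr 1; ring
        · ring
    · intro s hs
      have hs1 : ‖s‖ = 1/2 := by rw [hs]; norm_num
      have hre : |s.re| ≤ 1/2 := hs1 ▸ abs_re_le_norm s
      have := hL q ψ hψ (1 + dl + s) (by simp; linarith [(abs_le.mp hre).1]) (by
        calc ‖(1 + dl + s : ℂ)‖ ≤ ‖(1:ℂ)‖ + ‖(dl:ℂ)‖ + ‖s‖ := norm_add₃_le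
          _ ≤ 2 := by simp [abs_of_pos hdlpos, hs1]; linarith)
      refine this.trans (hexpM.trans ?_)
      simp only [add_zero]
      gcongr
    · intro s hs
      by_contra! hcon
      exact LFunction_ne_zero_of_one_le_re ψ (Or.inl hψ) (by simp; linarith) hs
  obtain ⟨a1, a2, a3⟩ := main χ hχ
  obtain ⟨-, b2, -⟩ := main (χ^2) hχ2
  have h341 := three_four_one χ dl hdlpos
  set D := (deriv χ.LFunction (1 + dl) / χ.LFunction (1 + dl)).re
  have hD : dl * D ≤ 9/10 + 3 * (M * dl) := by
    have h1 : 4 * D ≤ 18 / 5 / dl + 12 * M := by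
      have : 18 / 5 / dl = 3 * (6 / 5 / dl) := by ring
      linarith
    have h2 : dl * (4 * D) ≤ dl * (18 / 5 / dl + 12 * M) := by gcongr
    have h3 : dl * (18 / 5 / dl + 12 * M) = 18/5 + 12 * (M * dl) := by field_simp
    linarith
  refine le_trans ?_ a3
  have hexp : 1/2 ≤ Real.exp (-(24 * (M * dl))) := by
    have := Real.add_one_le_exp (-(24 * (M * dl)))
    linarith
  calc c₀ / 80 / l = (dl / 2) * (1/2) * (1/20) := by rw [hdl]; field_simp; norm_num
    _ ≤ _ := by
      gcongr
      linarith

end Notations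


lemma L_one_tendsto {q : ℕ} [NeZero q] (χ : DirichletCharacter ℂ q) (hχ : χ ≠ 1) :
    Filter.Tendsto (fun N => ∑ n ∈ Finset.range N, χ ((n : ℕ) : ZMod q) / (n : ℂ)) Filter.atTop
      (nhds (χ.LFunction 1)) := by
  have h := aterm_tendsto χ hχ 1 (by norm_num)
  rw [← L_eq_aterm χ hχ 1 (by norm_num) (by norm_num)] at h
  rw [← Filter.tendsto_add_atTop_iff_nat 1]
  refine h.congr fun N => ?_
  rw [Finset.sum_range_succ']
  simp [Complex.cpow_neg, div_eq_mul_inv]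

open ZMod in
lemma norm_std_addChar {p : ℕ} [NeZero p] (a : ZMod p) : ‖(stdAddChar a : ℂ)‖ = 1 := by
  rw [stdAddChar_apply]; exact Circle.norm_coe _

open ZMod in
lemma one_sub_std_re_pos {p : ℕ} [NeZero p] (a : ZMod p) (ha : a ≠ 0) :
    0 < (1 - (stdAddChar a : ℂ)).re := by
  have h1 := norm_std_addChar a
  have h2 : (stdAddChar a : ℂ) ≠ 1 := by
    intro h
    apply ha
    apply injective_stdAddChar (N := p)
    rw [h]; simp
  have h3 : (stdAddChar a : ℂ).re ≤ 1 := h1 ▸ Complex.re_le_norm _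
  rcases lt_or_eq_of_le h3 with h | h
  · simpa using h
  · exfalso; apply h2
    have h4 : (stdAddChar a : ℂ).re ^ 2 + (stdAddChar a : ℂ).im ^ 2 = 1 := by
      have := Complex.sq_norm (stdAddChar a : ℂ)
      rw [h1, Complex.normSq_apply] at this
      nlinarith
    have h5 : (stdAddChar a : ℂ).im = 0 := by
      rw [h] at h4
      have : (stdAddChar a : ℂ).im ^ 2 = 0 := by linarith
      exact pow_eq_zero_iff (two_ne_zero) |>.1 this
    exact Complex.ext (by simpa using h) (by simpa using h5)

lemma isPrimitive_of_prime {p : ℕ} [hp : Fact p.Prime] (χ : DirichletCharacter ℂ p) (hχ : χ ≠ 1) :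
    χ.IsPrimitive := by
  have : NeZero p := ⟨hp.1.ne_zero⟩
  rw [isPrimitive_def]
  rcases (Nat.dvd_prime hp.1).1 (conductor_dvd_level χ) with h | h
  · exact absurd (eq_one_iff_conductor_eq_one.2 h) hχ
  · exact h

open ZMod in
lemma tau_mul_L {p : ℕ} [hp : Fact p.Prime] (χ : DirichletCharacter ℂ p) (hχ : χ ≠ 1)
    (hq : χ ^ 2 = 1) :
    gaussSum χ stdAddChar * χ.LFunction 1 = - ∑ a : ZMod p, χ a * log (1 - stdAddChar a) := by
  have hinv : χ⁻¹ = χ := by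
    rw [inv_eq_iff_mul_eq_one, ← sq, hq]
  have h1 : ∀ n : ZMod p, gaussSum χ stdAddChar * χ n = ∑ a : ZMod p, χ a * stdAddChar (n * a) := by
    intro n
    have := gaussSum_mulShift_of_isPrimitive stdAddChar (isPrimitive_of_prime χ hχ) n
    rw [hinv] at this
    rw [mul_comm, ← this]
    simp [gaussSum, AddChar.mulShift_apply]
  have h2 := Complex.tendsto_tsum_powerSeries_nhdsWithin_lt (L_one_tendsto χ hχ)
  rw [Filter.tendsto_map'_iff] at h2
  have h3 : Filter.Tendsto (fun r : ℝ => - ∑ a : ZMod p, χ a * log (1 - r * stdAddChar a))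
      (nhdsWithin 1 (Set.Iio 1)) (nhds (- ∑ a : ZMod p, χ a * log (1 - stdAddChar a))) := by
    apply Filter.Tendsto.mono_left _ nhdsWithin_le_nhds
    apply Filter.Tendsto.neg
    apply tendsto_finsetSum
    intro a _
    by_cases ha : a = 0
    · subst ha
      simp [MulCharClass.map_nonunit]
    · apply Filter.Tendsto.const_mul
      apply Filter.Tendsto.clog
      · have : Filter.Tendsto (fun r : ℝ => 1 - (r : ℂ) * stdAddChar a) (nhds 1)
            (nhds (1 - ((1 : ℝ) : ℂ) * stdAddChar a)) := by
          apply Continuous.tendsto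
          fun_prop
        simpa using this
      · left; exact one_sub_std_re_pos a ha
  refine tendsto_nhds_unique (h2.const_mul (gaussSum χ stdAddChar)) (h3.congr' ?_)
  have : Set.Ioo (0 : ℝ) 1 ∈ nhdsWithin (1 : ℝ) (Set.Iio 1) := Ioo_mem_nhdsLT (by norm_num)
  filter_upwards [this] with r hr
  have h4 : HasSum (fun n : ℕ => ∑ a : ZMod p, χ a * (((r : ℂ) * stdAddChar a) ^ n / n))
      (∑ a : ZMod p, χ a * (- log (1 - r * stdAddChar a))) := by
    apply hasSum_sum
    intro a _
    apply HasSum.mul_left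
    apply hasSum_taylorSeries_neg_log
    rw [norm_mul, norm_std_addChar, Complex.norm_real, Real.norm_eq_abs, abs_of_pos hr.1]
    linarith [hr.2]
  simp only [Function.comp]
  rw [← tsum_mul_left]
  have h5 := h4.tsum_eq
  simp only [mul_neg, Finset.sum_neg_distrib] at h5
  rw [← h5]
  congr 1
  ext n
  rw [← mul_assoc, ← mul_div_assoc, h1, Finset.sum_div, Finset.sum_mul]
  apply Finset.sum_congr rfl
  intro a _
  rw [show (n : ZMod p) * a = n • a by simp, AddChar.map_nsmul_eq_pow, mul_pow]
  ring

open scoped Classical in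
/-- Product of `1 - e(c a)` over the level set `χ a = ε`. -/
noncomputable def nprod {p : ℕ} [NeZero p] (χ : DirichletCharacter ℂ p) (ε : ℂ) (c : ZMod p) : ℂ :=
  ∏ a ∈ Finset.univ.filter (fun a : ZMod p => χ a = ε), (1 - ZMod.stdAddChar (c * a))

lemma quad_values {p : ℕ} [hp : Fact p.Prime] (χ : DirichletCharacter ℂ p) (hq : χ ^ 2 = 1)
    (a : ZMod p) (ha : a ≠ 0) : χ a = 1 ∨ χ a = -1 := by
  have h : χ a ^ 2 = 1 := by
    rw [← MulChar.pow_apply' _ two_ne_zero, hq, MulChar.one_apply (IsUnit.mk0 _ ha)]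
  rw [sq] at h
  exact mul_self_eq_one_iff.1 h

lemma nprod_smul {p : ℕ} [hp : Fact p.Prime] (χ : DirichletCharacter ℂ p)
    (ε : ℂ) (c : ZMod p) (hc : c ≠ 0) : nprod χ ε c = nprod χ (χ c * ε) 1 := by
  classical
  have hχc : χ c ≠ 0 := by
    have := (IsUnit.mk0 c hc).map χ
    exact this.ne_zero
  unfold nprod
  refine Finset.prod_bij (fun a _ => c * a) ?_ ?_ ?_ ?_
  · intro a ha
    simp only [Finset.mem_filter, Finset.mem_univ, true_and] at ha ⊢
    rw [map_mul, ha]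
  · intro a _ b _ h
    exact mul_left_cancel₀ hc h
  · intro b hb
    simp only [Finset.mem_filter, Finset.mem_univ, true_and] at hb
    refine ⟨c⁻¹ * b, ?_, by field_simp⟩
    simp only [Finset.mem_filter, Finset.mem_univ, true_and]
    apply mul_left_cancel₀ hχc
    rw [← map_mul, ← hb]
    congr 1
    field_simp
  · intro a _; simp

lemma nprod_add_smul {p : ℕ} [hp : Fact p.Prime] (χ : DirichletCharacter ℂ p) (hq : χ ^ 2 = 1)
    (c : ZMod p) (hc : c ≠ 0) :
    nprod χ 1 c + nprod χ (-1) c = nprod χ 1 1 + nprod χ (-1) 1 := by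
  rw [nprod_smul χ 1 c hc, nprod_smul χ (-1) c hc]
  rcases quad_values χ hq c hc with h | h <;> rw [h] <;> norm_num [add_comm]

lemma nprod_sum_int {p : ℕ} [hp : Fact p.Prime] (χ : DirichletCharacter ℂ p) (ε : ℂ) :
    ∃ m : ℤ, ∑ c : ZMod p, nprod χ ε c = p * m := by
  classical
  unfold nprod
  simp only [sub_eq_add_neg, Finset.prod_one_add]
  rw [Finset.sum_comm]
  have : ∀ U : Finset (ZMod p), ∃ m : ℤ,
      ∑ c : ZMod p, ∏ a ∈ U, -(ZMod.stdAddChar (c * a) : ℂ) = p * m := by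
    intro U
    refine ⟨(-1) ^ U.card * if (∑ a ∈ U, a) = 0 then 1 else 0, ?_⟩
    have h1 : ∀ c : ZMod p, ∏ a ∈ U, -(ZMod.stdAddChar (c * a) : ℂ)
        = (-1) ^ U.card * ZMod.stdAddChar (c * (∑ a ∈ U, a)) := by
      intro c
      rw [Finset.prod_neg, Finset.mul_sum]
      congr 1
      induction U using Finset.induction_on with
      | empty => simp
      | insert a U ha ih => rw [Finset.prod_insert ha, Finset.sum_insert ha,
          AddChar.map_add_eq_mul, ih]
    simp only [h1]
    rw [← Finset.mul_sum, AddChar.sum_mulShift _ (ZMod.isPrimitive_stdAddChar p)]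
    split_ifs <;> simp [mul_comm]
  choose m hm using this
  refine ⟨∑ U ∈ (Finset.univ.filter (fun a : ZMod p => χ a = ε)).powerset, m U, ?_⟩
  simp only [hm]
  rw [← Finset.mul_sum]
  push_cast
  rfl

lemma nprod_zero {p : ℕ} [hp : Fact p.Prime] (χ : DirichletCharacter ℂ p) (ε : ℂ)
    (h : ∃ a, χ a = ε) : nprod χ ε 0 = 0 := by
  classical
  obtain ⟨a, ha⟩ := h
  unfold nprod
  apply Finset.prod_eq_zero (i := a) (by simp [ha])
  simp

lemma nprod_isIntegral {p : ℕ} [hp : Fact p.Prime] (χ : DirichletCharacter ℂ p) (ε : ℂ)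
    (c : ZMod p) : IsIntegral ℤ (nprod χ ε c) := by
  classical
  unfold nprod
  apply IsIntegral.prod
  intro a _
  apply IsIntegral.sub isIntegral_one
  apply IsIntegral.of_pow hp.1.pos
  rw [← AddChar.map_nsmul_eq_pow]
  simp [isIntegral_one]

lemma nprod_conj {p : ℕ} [hp : Fact p.Prime] (χ : DirichletCharacter ℂ p) (he : χ.Even) (ε : ℂ) :
    (starRingEnd ℂ) (nprod χ ε 1) = nprod χ ε 1 := by
  have h1 : (starRingEnd ℂ) (nprod χ ε 1) = nprod χ ε (-1) := by
    unfold nprod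
    rw [map_prod]
    apply Finset.prod_congr rfl
    intro a _
    rw [map_sub, map_one, ← AddChar.map_neg_eq_conj, neg_mul]
  rw [h1, nprod_smul χ ε (-1) (by simp)]
  rw [show χ (-1) = 1 from he, one_mul]

lemma nprod_mul {p : ℕ} [hp : Fact p.Prime] (χ : DirichletCharacter ℂ p) (hq : χ ^ 2 = 1) :
    nprod χ 1 1 * nprod χ (-1) 1 = p := by
  classical
  unfold nprod
  rw [← Finset.prod_union]
  · have h1 : (Finset.univ.filter (fun a : ZMod p => χ a = 1)) ∪
        (Finset.univ.filter (fun a : ZMod p => χ a = -1)) = Finset.univ.filter (· ≠ 0) := by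
      ext a
      simp only [Finset.mem_union, Finset.mem_filter, Finset.mem_univ, true_and]
      constructor
      · rintro (h | h) rfl <;> simp [MulCharClass.map_nonunit] at h
      · exact quad_values χ hq a
    rw [h1]
    obtain ⟨n, rfl⟩ : ∃ n, p = n + 1 := ⟨p - 1, by have := hp.1.pos; omega⟩
    have hprim : IsPrimitiveRoot (ZMod.stdAddChar (1 : ZMod (n + 1)) : ℂ) (n + 1) := by
      have := Complex.isPrimitiveRoot_exp (n + 1) (by omega)
      convert this using 1
      have h := ZMod.stdAddChar_coe (N := n + 1) 1
      push_cast at h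
      rw [h]
      push_cast
      ring_nf
    have h2 := hprim.prod_one_sub_pow_eq_order
    push_cast
    rw [← h2]
    symm
    refine Finset.prod_bij (fun k _ => ((k + 1 : ℕ) : ZMod (n + 1))) ?_ ?_ ?_ ?_
    · intro k hk
      simp only [Finset.mem_filter, Finset.mem_univ, true_and, ne_eq]
      rw [ZMod.natCast_eq_zero_iff]
      intro h
      have := Nat.le_of_dvd (by omega) h
      have := Finset.mem_range.1 hk
      omega
    · intro a ha b hb h
      rw [ZMod.natCast_eq_natCast_iff'] at h
      have h1 := Finset.mem_range.1 ha
      have h2 := Finset.mem_range.1 hb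
      rw [Nat.mod_eq_of_lt (by omega), Nat.mod_eq_of_lt (by omega)] at h
      omega
    · intro b hb
      simp only [Finset.mem_filter, Finset.mem_univ, true_and] at hb
      have h1 := ZMod.val_lt b
      have h2 : b.val ≠ 0 := by rwa [ne_eq, ZMod.val_eq_zero]
      refine ⟨b.val - 1, Finset.mem_range.2 (by omega), ?_⟩
      rw [Nat.sub_add_cancel (by omega)]
      simp
    · intro k _
      rw [← AddChar.map_nsmul_eq_pow]
      simp
  · rw [Finset.disjoint_filter]
    intro a _ h1 h2
    rw [h1] at h2
    norm_num at h2

lemma nprod_norm_add {p : ℕ} [hp : Fact p.Prime] (χ : DirichletCharacter ℂ p) (hχ : χ ≠ 1)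
    (hq : χ ^ 2 = 1) (he : χ.Even) : (p : ℝ) ≤ ‖nprod χ 1 1‖ + ‖nprod χ (-1) 1‖ := by
  obtain ⟨m1, h1⟩ := nprod_sum_int χ 1
  obtain ⟨m2, h2⟩ := nprod_sum_int χ (-1)
  have hneg : ∃ a, χ a = -1 := by
    by_contra! h
    apply hχ
    ext a
    rw [MulChar.one_apply a.isUnit]
    exact (quad_values χ hq a a.ne_zero).resolve_right (h a)
  set S : ℂ := nprod χ 1 1 + nprod χ (-1) 1 with hS
  have hsum : ∑ c : ZMod p, (nprod χ 1 c + nprod χ (-1) c) = (p - 1) * S := by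
    rw [← Finset.sum_erase_add _ _ (Finset.mem_univ (0 : ZMod p)), nprod_zero χ 1 ⟨1, by simp⟩,
      nprod_zero χ (-1) hneg, add_zero, add_zero]
    rw [Finset.sum_congr rfl (g := fun _ => S)]
    · rw [Finset.sum_const, Finset.card_erase_of_mem (Finset.mem_univ _), Finset.card_univ,
        ZMod.card, nsmul_eq_mul, Nat.cast_sub hp.1.one_le]
      simp
    · intro c hc
      exact nprod_add_smul χ hq c (Finset.ne_of_mem_erase hc)
  rw [Finset.sum_add_distrib, h1, h2] at hsum
  have hp1 : ((p : ℂ) - 1) ≠ 0 := by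
    rw [sub_ne_zero]
    exact_mod_cast hp.1.one_lt.ne'
  have hrat : S = algebraMap ℚ ℂ ((p : ℚ) * (m1 + m2) / (p - 1)) := by
    simp only [eq_ratCast]
    push_cast
    field_simp
    rw [mul_comm S, ← hsum]
    ring
  have hSint : IsIntegral ℤ S := (nprod_isIntegral χ 1 1).add (nprod_isIntegral χ (-1) 1)
  rw [hrat, isIntegral_algebraMap_iff (algebraMap ℚ ℂ).injective,
    IsIntegrallyClosed.isIntegral_iff] at hSint
  obtain ⟨n, hn⟩ := hSint
  have hSn : S = n := by
    rw [hrat, ← hn]; simp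
  have hdvd : (p : ℤ) ∣ n := by
    have h3 : ((p : ℤ) - 1) * n = p * (m1 + m2) := by
      rw [hSn] at hsum
      have : ((((p : ℤ) - 1) * n : ℤ) : ℂ) = ((p * (m1 + m2) : ℤ) : ℂ) := by
        push_cast
        rw [← hsum]; ring
      exact_mod_cast this
    exact ⟨n - (m1 + m2), by linarith⟩
  have hn0 : n ≠ 0 := by
    rintro rfl
    have hmul := nprod_mul χ hq
    obtain ⟨x, hx⟩ := Complex.conj_eq_iff_real.1 (nprod_conj χ he 1)
    have h4 : nprod χ (-1) 1 = -x := by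
      rw [← hx]; apply eq_neg_of_add_eq_zero_right
      rw [← hS, hSn]; simp
    rw [h4, hx] at hmul
    have h5 : x * -x = p := by exact_mod_cast hmul
    have h6 : (0 : ℝ) < p := by exact_mod_cast hp.1.pos
    nlinarith [sq_nonneg x]
  have h7 : (p : ℤ) ≤ |n| := Int.le_of_dvd (abs_pos.2 hn0) ((dvd_abs _ _).2 hdvd)
  calc (p : ℝ) ≤ ((|n| : ℤ) : ℝ) := by exact_mod_cast h7
    _ = ‖S‖ := by rw [hSn]; simp
    _ ≤ _ := norm_add_le _ _

lemma log_ratio_aux (x y P : ℝ) (hx : 0 < x) (hy : 0 < y) (hP : 5 ≤ P) (hxy : x * y = P)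
    (hs : P ≤ x + y) : Real.log 2 ≤ |Real.log x - Real.log y| := by
  wlog h : y ≤ x generalizing x y
  · rw [abs_sub_comm]
    exact this y x hy hx (by linarith) (by linarith) (by linarith)
  have h2 : 2 * y ≤ x := by
    by_contra! hlt
    nlinarith
  have := Real.log_le_log (by positivity) h2
  rw [Real.log_mul (by norm_num) hy.ne'] at this
  exact le_trans (by linarith) (le_abs_self _)

lemma quad_lower {p : ℕ} [hp : Fact p.Prime] (χ : DirichletCharacter ℂ p) (hχ : χ ≠ 1)
    (hq : χ ^ 2 = 1) (he : χ.Even) (h5 : 5 ≤ p) :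
    (Real.log 2) ^ 2 ≤ p * ‖χ.LFunction 1‖ ^ 2 := by
  classical
  have h1 := tau_mul_L χ hχ hq
  have hmul : ‖nprod χ 1 1‖ * ‖nprod χ (-1) 1‖ = p := by
    rw [← norm_mul, nprod_mul χ hq]; simp
  have hp0 : (0 : ℝ) < p := by exact_mod_cast hp.1.pos
  have hx : 0 < ‖nprod χ 1 1‖ := by
    rcases (norm_nonneg (nprod χ 1 1)).lt_or_eq with h | h
    · exact h
    · rw [← h] at hmul; simp at hmul; linarith
  have hy : 0 < ‖nprod χ (-1) 1‖ := by
    rcases (norm_nonneg (nprod χ (-1) 1)).lt_or_eq with h | h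
    · exact h
    · rw [← h] at hmul; simp at hmul; linarith
  have h2 := log_ratio_aux _ _ p hx hy (by exact_mod_cast h5) hmul (nprod_norm_add χ hχ hq he)
  have hlog : ∀ ε : ℂ, (ε = 1 ∨ ε = -1) → Real.log ‖nprod χ ε 1‖ =
      ∑ a ∈ Finset.univ.filter (fun a : ZMod p => χ a = ε),
        Real.log ‖1 - (ZMod.stdAddChar a : ℂ)‖ := by
    intro ε hε
    unfold nprod
    rw [norm_prod, Real.log_prod]
    · simp
    · intro a ha
      simp only [Finset.mem_filter, Finset.mem_univ, true_and] at ha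
      have ha0 : a ≠ 0 := by
        rintro rfl
        rw [MulCharClass.map_nonunit χ (by simp)] at ha
        rcases hε with h | h <;> rw [h] at ha <;> norm_num at ha
      rw [one_mul]
      intro h
      have := one_sub_std_re_pos a ha0
      rw [norm_eq_zero] at h
      rw [h] at this
      simp at this
  have hre : (∑ a : ZMod p, χ a * log (1 - ZMod.stdAddChar a)).re =
      Real.log ‖nprod χ 1 1‖ - Real.log ‖nprod χ (-1) 1‖ := by
    rw [hlog 1 (Or.inl rfl), hlog (-1) (Or.inr rfl), Finset.sum_filter, Finset.sum_filter,
      ← Finset.sum_sub_distrib, Complex.re_sum]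
    apply Finset.sum_congr rfl
    intro a _
    by_cases ha : a = 0
    · subst ha
      rw [MulCharClass.map_nonunit χ (by simp)]
      norm_num
    · rcases quad_values χ hq a ha with h | h <;> rw [h] <;> norm_num [Complex.log_re]
  have htau : ‖gaussSum χ ZMod.stdAddChar‖ ^ 2 = p := by
    have hquad : MulChar.IsQuadratic χ := by
      intro a
      by_cases ha : a = 0
      · left; subst ha; exact MulCharClass.map_nonunit χ (by simp)
      · right; exact quad_values χ hq a ha
    rw [← norm_pow, gaussSum_sq hχ hquad (ZMod.isPrimitive_stdAddChar p),
      show χ (-1) = 1 from he, ZMod.card]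
    simp
  have h3 : Real.log 2 ≤ ‖gaussSum χ ZMod.stdAddChar * χ.LFunction 1‖ := by
    rw [h1, norm_neg]
    refine h2.trans ?_
    rw [← hre]
    exact Complex.abs_re_le_norm _
  have h4 := pow_le_pow_left₀ (Real.log_nonneg (by norm_num)) h3 2
  rwa [norm_mul, mul_pow, htau] at h4

lemma card_factors (n d : ℕ) [NeZero n] [NeZero d] (s : Finset (DirichletCharacter ℂ n))
    (hs : ∀ χ ∈ s, χ.FactorsThrough d) : s.card ≤ d := by
  classical
  rcases s.eq_empty_or_nonempty with rfl | ⟨χ1, h1⟩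
  · simp
  have hd : d ∣ n := (hs χ1 h1).dvd
  have hsub : s ⊆ (Finset.univ : Finset (DirichletCharacter ℂ d)).image (changeLevel hd) := by
    intro χ hχ
    rw [Finset.mem_image]
    exact ⟨(hs χ hχ).χ₀, Finset.mem_univ _, (hs χ hχ).eq_changeLevel.symm⟩
  calc s.card ≤ _ := Finset.card_le_card hsub
    _ ≤ (Finset.univ : Finset (DirichletCharacter ℂ d)).card := Finset.card_image_le
    _ = d.totient := by
      rw [Finset.card_univ, ← Nat.card_eq_fintype_card,
        DirichletCharacter.card_eq_totient_of_hasEnoughRootsOfUnity ℂ d]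
    _ ≤ d := Nat.totient_le d

lemma L_one_changeLevel {M N p : ℕ} [NeZero M] [NeZero N] (hMN : M ∣ N) (hN : N.primeFactors = {p})
    (hpM : p ∣ M) (ψ : DirichletCharacter ℂ M) (hψ : ψ ≠ 1) :
    (changeLevel hMN ψ).LFunction 1 = ψ.LFunction 1 := by
  rw [LFunction_changeLevel hMN ψ (Or.inl hψ), hN, Finset.prod_singleton]
  have hp : p.Prime := Nat.prime_of_mem_primeFactors (n := N) (by rw [hN]; simp)
  have : ψ (p : ZMod M) = 0 := by
    apply MulChar.map_nonunit
    rw [ZMod.isUnit_iff_coprime]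
    intro h
    have h2 : p ∣ Nat.gcd p M := Nat.dvd_gcd dvd_rfl hpM
    rw [Nat.Coprime] at h
    rw [h] at h2
    exact hp.one_lt.ne' (Nat.dvd_one.1 h2)
  rw [this]; simp

lemma L_one_finite (M : ℕ) [NeZero M] :
    ∃ c > (0 : ℝ), ∀ ψ : DirichletCharacter ℂ M, ψ ≠ 1 → c ≤ ‖ψ.LFunction 1‖ := by
  classical
  by_cases h : (Finset.univ.filter (fun ψ : DirichletCharacter ℂ M => ψ ≠ 1)).Nonempty
  · obtain ⟨ψ, h1, h2⟩ := Finset.exists_min_image _ (fun ψ => ‖ψ.LFunction 1‖) h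
    refine ⟨‖ψ.LFunction 1‖, ?_, ?_⟩
    · rw [gt_iff_lt, norm_pos_iff]
      exact LFunction_apply_one_ne_zero (Finset.mem_filter.1 h1).2
    · intro φ hφ
      exact h2 φ (by simp [hφ])
  · refine ⟨1, one_pos, fun ψ hψ => absurd ⟨ψ, by simp [hψ]⟩ h⟩

lemma quad_unit {n : ℕ} (χ : DirichletCharacter ℂ n) (hq : χ ^ 2 = 1) (u : (ZMod n)ˣ) :
    χ.toUnitHom u ^ 2 = 1 := by
  ext
  push_cast
  rw [MulChar.coe_toUnitHom, ← MulChar.pow_apply' _ two_ne_zero, hq, MulChar.one_apply u.isUnit]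

lemma quad_factor_odd {p k : ℕ} (hp : p.Prime) (hk : 1 ≤ k) (h2 : p ≠ 2)
    (χ : DirichletCharacter ℂ (p ^ k)) (hq : χ ^ 2 = 1) : χ.FactorsThrough p := by
  have : NeZero (p ^ k) := ⟨pow_ne_zero k hp.ne_zero⟩
  have : NeZero p := ⟨hp.ne_zero⟩
  have hd : p ∣ p ^ k := dvd_pow_self p (by omega)
  rw [factorsThrough_iff_ker_unitsMap hd]
  intro u hu
  rw [MonoidHom.mem_ker] at hu ⊢
  have hu' : ((u : ZMod (p ^ k)).cast : ZMod p) = 1 := by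
    have := congrArg Units.val hu
    simpa [ZMod.unitsMap_def] using this
  have hdiv : (p : ZMod (p ^ k)) ∣ (u : ZMod (p ^ k)) - 1 := by
    rw [ZMod.cast_eq_val] at hu'
    have h3 : (((u : ZMod (p ^ k)).val : ℤ) : ZMod p) = ((1 : ℤ) : ZMod p) := by
      push_cast; exact hu'
    rw [ZMod.intCast_eq_intCast_iff_dvd_sub] at h3
    obtain ⟨t, ht⟩ := h3
    refine ⟨-(t : ZMod (p ^ k)), ?_⟩
    have h4 := congrArg (fun z : ℤ => (z : ZMod (p ^ k))) ht
    simp only [Int.cast_sub, Int.cast_one, Int.cast_natCast, Int.cast_mul,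
      ZMod.natCast_zmod_val] at h4
    linear_combination -h4
  have h5 := dvd_sub_pow_of_dvd_sub hdiv (k - 1)
  rw [Nat.sub_add_cancel hk, ← Nat.cast_pow, ZMod.natCast_self, zero_dvd_iff, one_pow,
    sub_eq_zero] at h5
  have h6 : u ^ (p ^ (k - 1)) = 1 := by
    ext; push_cast; exact h5
  have hodd : Odd (p ^ (k - 1)) := (hp.odd_of_ne_two h2).pow
  obtain ⟨m, hm⟩ := hodd
  have h7 := congrArg χ.toUnitHom h6
  rw [hm, map_pow, map_one, pow_succ, pow_mul, quad_unit χ hq, one_pow, one_mul] at h7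
  exact h7

lemma two_adic_sq (a : ℤ) (ha : (8 : ℤ) ∣ a - 1) (k : ℕ) :
    ∃ x : ℤ, Odd x ∧ (2 : ℤ) ^ (k + 3) ∣ x ^ 2 - a := by
  induction k with
  | zero => exact ⟨1, odd_one, by rw [one_pow, dvd_sub_comm]; simpa using ha⟩
  | succ k ih =>
    obtain ⟨x, ⟨m, hm⟩, t, ht⟩ := ih
    rcases Int.even_or_odd t with ⟨s, hs⟩ | ⟨s, hs⟩
    · exact ⟨x, ⟨m, hm⟩, s, by rw [ht, hs]; ring⟩
    · refine ⟨x + 2 ^ (k + 2), ⟨m + 2 ^ (k + 1), by rw [hm]; ring⟩, s + m + 1 + 2 ^ k, ?_⟩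
      have : (x + 2 ^ (k + 2)) ^ 2 - a = (x ^ 2 - a) + 2 ^ (k + 3) * x + 2 ^ (2 * k + 4) := by ring
      rw [this, ht, hs, hm]
      ring

lemma quad_factor_two {k : ℕ} (hk : 3 ≤ k)
    (χ : DirichletCharacter ℂ (2 ^ k)) (hq : χ ^ 2 = 1) : χ.FactorsThrough 8 := by
  have hd : 8 ∣ 2 ^ k := by
    rw [show 8 = 2 ^ 3 by norm_num]; exact pow_dvd_pow 2 hk
  rw [factorsThrough_iff_ker_unitsMap hd]
  intro u hu
  rw [MonoidHom.mem_ker] at hu ⊢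
  have hu' : ((u : ZMod (2 ^ k)).cast : ZMod 8) = 1 := by
    have := congrArg Units.val hu
    simpa [ZMod.unitsMap_def] using this
  rw [ZMod.cast_eq_val] at hu'
  have h3 : ((1 : ℤ) : ZMod 8) = (((u : ZMod (2 ^ k)).val : ℤ) : ZMod 8) := by
    push_cast; exact hu'.symm
  rw [ZMod.intCast_eq_intCast_iff_dvd_sub] at h3
  obtain ⟨x, -, t, ht⟩ := two_adic_sq _ h3 (k - 3)
  rw [Nat.sub_add_cancel hk] at ht
  have h4 := congrArg (fun z : ℤ => (z : ZMod (2 ^ k))) ht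
  have h0 : (2 : ZMod (2 ^ k)) ^ k = 0 := by
    have := ZMod.natCast_self (2 ^ k)
    push_cast at this
    exact this
  simp only [Int.cast_sub, Int.cast_natCast, Int.cast_mul, Int.cast_pow, Int.cast_ofNat,
      ZMod.natCast_zmod_val, h0, zero_mul, sub_eq_zero] at h4
  have hx : IsUnit (x : ZMod (2 ^ k)) := by
    have : IsUnit ((x : ZMod (2 ^ k)) ^ 2) := by rw [h4]; exact u.isUnit
    exact (isUnit_pow_iff two_ne_zero).1 this
  have h5 : u = hx.unit ^ 2 := by
    ext; push_cast; simp [h4]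
  rw [h5, map_pow, quad_unit χ hq]

lemma quad_count (p k : ℕ) (hp : p.Prime) [NeZero (p ^ k)] (hk : 1 ≤ k)
    (s : Finset (DirichletCharacter ℂ (p ^ k)))
    (hs : ∀ χ ∈ s, χ ^ 2 = 1) : s.card ≤ 8 := by
  classical
  by_cases h2 : p = 2
  · subst h2
    by_cases h3 : 3 ≤ k
    · exact card_factors _ 8 s (fun χ h => quad_factor_two h3 χ (hs χ h))
    · refine (card_factors _ (2 ^ k) s (fun χ h => FactorsThrough.same_level χ)).trans ?_
      calc 2 ^ k ≤ 2 ^ 3 := Nat.pow_le_pow_right (by norm_num) (by omega)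
        _ = 8 := by norm_num
  · have : Fact p.Prime := ⟨hp⟩
    have hc : IsCyclic (ZMod (p ^ k))ˣ := ZMod.isCyclic_units_of_prime_pow p hp h2 k
    obtain ⟨g, hg⟩ := hc.exists_generator
    have h4 : s.card ≤ ({1, -1} : Finset ℂˣ).card := by
      apply Finset.card_le_card_of_injOn (fun χ => χ.toUnitHom g)
      · intro χ hχ
        have h5 := quad_unit χ (hs χ hχ) g
        simp only [Finset.coe_insert, Finset.coe_singleton, Set.mem_insert_iff,
          Set.mem_singleton_iff]
        have h6 : ((χ.toUnitHom g : ℂˣ) : ℂ) ^ 2 = 1 := by have := congrArg Units.val h5; push_cast at this; exact this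
        rw [sq] at h6
        rcases mul_self_eq_one_iff.1 h6 with h | h
        · left; ext; exact h
        · right; ext; rw [h]; simp
      · intro χ _ ψ _ h
        rw [← toUnitHom_inj]
        ext x
        obtain ⟨n, hn⟩ := Subgroup.mem_zpowers_iff.1 (hg x)
        simp only at h
        rw [← hn, map_zpow, map_zpow, h]
    exact h4.trans ((Finset.card_le_two).trans (by norm_num))

lemma sum_inv_conductor (p k : ℕ) (hp : p.Prime) [NeZero (p ^ k)]
    (s : Finset (DirichletCharacter ℂ (p ^ k))) (hs : ∀ χ ∈ s, χ ≠ 1) :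
    ∑ χ ∈ s, 1 / (χ.conductor : ℝ) ≤ k := by
  classical
  have h1 : ∀ χ ∈ s, 1 / (χ.conductor : ℝ) ≤
      ∑ j ∈ Finset.Icc 1 k, if χ.conductor = p ^ j then 1 / ((p ^ j : ℕ) : ℝ) else 0 := by
    intro χ hχ
    obtain ⟨j, hj, hc⟩ := (Nat.dvd_prime_pow hp).1 (conductor_dvd_level χ)
    have hj0 : j ≠ 0 := by
      rintro rfl
      exact hs χ hχ (eq_one_iff_conductor_eq_one.2 (by rw [hc, pow_zero]))
    refine le_trans ?_ (Finset.single_le_sum (f := fun j => if χ.conductor = p ^ j then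
      1 / ((p ^ j : ℕ) : ℝ) else 0) (fun i _ => ?_) (Finset.mem_Icc.2 ⟨by omega, hj⟩))
    · simp only [hc, if_true]; exact le_rfl
    · split_ifs <;> positivity
  refine (Finset.sum_le_sum h1).trans ?_
  rw [Finset.sum_comm]
  have h2 : ∀ j ∈ Finset.Icc 1 k, (∑ χ ∈ s, if χ.conductor = p ^ j then
      1 / ((p ^ j : ℕ) : ℝ) else 0) ≤ 1 := by
    intro j _
    have : NeZero (p ^ j) := ⟨pow_ne_zero j hp.ne_zero⟩
    rw [← Finset.sum_filter, Finset.sum_const, nsmul_eq_mul, mul_one_div]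
    have hpos : (0 : ℝ) < ((p ^ j : ℕ) : ℝ) := by
      exact_mod_cast pow_pos hp.pos j
    rw [div_le_one hpos]
    have := card_factors (p ^ k) (p ^ j) (s.filter (fun χ => χ.conductor = p ^ j)) (by
      intro χ hχ
      rw [← (Finset.mem_filter.1 hχ).2]
      exact factorsThrough_conductor χ)
    exact_mod_cast this
  refine (Finset.sum_le_sum h2).trans ?_
  simp

lemma quad_term : ∃ B > (0 : ℝ), ∀ (p k : ℕ) (_ : p.Prime) (_ : 1 ≤ k) [NeZero (p ^ k)]
    (χ : DirichletCharacter ℂ (p ^ k)), χ ≠ 1 → χ.Even → χ ^ 2 = 1 →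
      1 / ((χ.conductor : ℝ) * ‖χ.LFunction 1‖ ^ 2) ≤ B := by
  obtain ⟨c3, hc3, h3⟩ := L_one_finite 3
  obtain ⟨c8, hc8, h8⟩ := L_one_finite 8
  have hl2 : 0 < Real.log 2 := Real.log_pos (by norm_num)
  refine ⟨1 / c3 ^ 2 + 1 / c8 ^ 2 + 1 / (Real.log 2) ^ 2, by positivity, ?_⟩
  intro p k hp hk _ χ hχ he hq
  have hp3 : 0 < 1 / c3 ^ 2 := by positivity
  have hp8 : 0 < 1 / c8 ^ 2 := by positivity
  have hpl : 0 < 1 / (Real.log 2) ^ 2 := by positivity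
  have hf1 : (1 : ℝ) ≤ χ.conductor := by
    exact_mod_cast Nat.one_le_iff_ne_zero.2 (conductor_ne_zero χ)
  have hpf : (p ^ k).primeFactors = {p} := Nat.primeFactors_prime_pow (by omega) hp
  have key : ∀ c : ℝ, 0 < c → c ≤ ‖χ.LFunction 1‖ →
      1 / ((χ.conductor : ℝ) * ‖χ.LFunction 1‖ ^ 2) ≤ 1 / c ^ 2 := by
    intro c hc hle
    apply one_div_le_one_div_of_le (by positivity)
    have := pow_le_pow_left₀ hc.le hle 2
    nlinarith [sq_nonneg ‖χ.LFunction 1‖]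
  by_cases h2 : p = 2
  · subst h2
    have : c8 ≤ ‖χ.LFunction 1‖ := by
      by_cases hk3 : 3 ≤ k
      · have hF := quad_factor_two hk3 χ hq
        have hE := hF.eq_changeLevel
        have hne : hF.χ₀ ≠ 1 := by
          intro h
          rw [h, map_one] at hE
          exact hχ hE
        rw [hE, L_one_changeLevel hF.dvd hpf (by norm_num) _ hne]
        exact h8 _ hne
      · have hd : 2 ^ k ∣ 8 := by
          rw [show 8 = 2 ^ 3 by norm_num]; exact pow_dvd_pow 2 (by omega)
        have hpf8 : (8 : ℕ).primeFactors = {2} := by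
          rw [show 8 = 2 ^ 3 by norm_num]
          exact Nat.primeFactors_prime_pow (by norm_num) hp
        rw [← L_one_changeLevel hd hpf8 (dvd_pow_self 2 (by omega)) χ hχ]
        apply h8
        rwa [ne_eq, changeLevel_eq_one_iff hd]
    linarith [key c8 hc8 this]
  · have : NeZero p := ⟨hp.ne_zero⟩
    have hF := quad_factor_odd hp hk h2 χ hq
    have hE := hF.eq_changeLevel
    have hne : hF.χ₀ ≠ 1 := by
      intro h
      rw [h, map_one] at hE
      exact hχ hE
    have hL : χ.LFunction 1 = hF.χ₀.LFunction 1 := by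
      conv_lhs => rw [hE]
      exact L_one_changeLevel hF.dvd hpf dvd_rfl _ hne
    by_cases h3' : p = 3
    · subst h3'
      have : c3 ≤ ‖χ.LFunction 1‖ := by
        rw [hL]; exact h3 _ hne
      linarith [key c3 hc3 this]
    · have h5 : 5 ≤ p := by
        have := hp.two_le
        by_contra! hlt
        interval_cases p <;> first | omega | (revert hp; decide)
      have : Fact p.Prime := ⟨hp⟩
      have hψq : hF.χ₀ ^ 2 = 1 := by
        apply changeLevel_injective hF.dvd
        rw [map_pow, ← hE, hq, map_one]
      have hψe : hF.χ₀.Even := by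
        have h6 : χ (-1) = 1 := he
        have h7 := changeLevel_eq_cast_of_dvd hF.χ₀ hF.dvd (-1)
        rw [← hE] at h7
        push_cast at h7
        rw [h6] at h7
        have h8 : ((-1 : ZMod (p ^ k)).cast : ZMod p) = -1 := by
          rw [ZMod.cast_neg hF.dvd, ZMod.cast_one hF.dvd]
        rw [h8] at h7
        exact h7.symm
      have hcond : χ.conductor = p := by
        have hd := conductor_dvd_of_mem_conductorSet (χ := χ) (d := p) hF
        rcases (Nat.dvd_prime hp).1 hd with h | h
        · exact absurd (eq_one_iff_conductor_eq_one.2 h) hχ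
        · exact h
      have h9 := quad_lower hF.χ₀ hne hψq hψe h5
      rw [hcond, hL]
      have := one_div_le_one_div_of_le (by positivity) h9
      linarith

open scoped Classical in
/-- Unconditionally, for a prime `p` and `k ≥ 1` with `q = p^k`, the sum
`Σ_{χ ≠ χ0, χ even} (f_χ |L(1,χ)|²)⁻¹` differs from its restriction to even non-quadratic
characters by `O(1)`, and is `≪ k³ (log p)²`, with absolute implied constants. -/
theorem unconditional_upper_bound :
    ∃ C > (0 : ℝ), ∀ (p k : ℕ) (hp : p.Prime) (_hk : 1 ≤ k),
      haveI : NeZero (p ^ k) := ⟨pow_ne_zero k hp.ne_zero⟩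
      |(∑ χ : DirichletCharacter ℂ (p ^ k),
          if χ ≠ 1 ∧ χ.Even then 1 / ((χ.conductor : ℝ) * ‖χ.LFunction 1‖ ^ 2) else 0) -
        (∑ χ : DirichletCharacter ℂ (p ^ k),
          if χ ≠ 1 ∧ χ.Even ∧ χ ^ 2 ≠ 1 then
            1 / ((χ.conductor : ℝ) * ‖χ.LFunction 1‖ ^ 2) else 0)| ≤ C ∧
      (∑ χ : DirichletCharacter ℂ (p ^ k),
          if χ ≠ 1 ∧ χ.Even then 1 / ((χ.conductor : ℝ) * ‖χ.LFunction 1‖ ^ 2) else 0) ≤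
        C * k ^ 3 * (Real.log p) ^ 2 := by
  obtain ⟨B, hB, hquad⟩ := quad_term
  obtain ⟨c, hc, hlow⟩ := L_one_lower
  have hl2 : 0 < Real.log 2 := Real.log_pos (by norm_num)
  refine ⟨8 * B + 8 * B / (Real.log 2) ^ 2 + 1 / c ^ 2, by positivity, ?_⟩
  intro p k hp hk
  have hne : NeZero (p ^ k) := ⟨pow_ne_zero k hp.ne_zero⟩
  set F : DirichletCharacter ℂ (p ^ k) → ℝ :=
    fun χ => 1 / ((χ.conductor : ℝ) * ‖χ.LFunction 1‖ ^ 2) with hF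
  have hF0 : ∀ χ, 0 ≤ F χ := fun χ => by positivity
  set S1 : ℝ := ∑ χ : DirichletCharacter ℂ (p ^ k), if χ ≠ 1 ∧ χ.Even then F χ else 0 with hS1
  set S2 : ℝ := ∑ χ : DirichletCharacter ℂ (p ^ k),
    if χ ≠ 1 ∧ χ.Even ∧ χ ^ 2 ≠ 1 then F χ else 0 with hS2
  set S3 : ℝ := ∑ χ : DirichletCharacter ℂ (p ^ k),
    if χ ≠ 1 ∧ χ.Even ∧ χ ^ 2 = 1 then F χ else 0 with hS3
  have hdec : S1 = S2 + S3 := by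
    rw [hS1, hS2, hS3, ← Finset.sum_add_distrib]
    apply Finset.sum_congr rfl
    intro χ _
    by_cases h1 : χ ≠ 1 ∧ χ.Even
    · by_cases h2 : χ ^ 2 = 1 <;> simp [h1.1, h1.2, h2]
    · have h3 : ¬ (χ ≠ 1 ∧ χ.Even ∧ χ ^ 2 ≠ 1) := fun h => h1 ⟨h.1, h.2.1⟩
      have h4 : ¬ (χ ≠ 1 ∧ χ.Even ∧ χ ^ 2 = 1) := fun h => h1 ⟨h.1, h.2.1⟩
      rw [if_neg h1, if_neg h3, if_neg h4, add_zero]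
  have hS3nn : 0 ≤ S3 := Finset.sum_nonneg fun χ _ => by
    split_ifs
    · exact hF0 χ
    · exact le_rfl
  have hS3le : S3 ≤ 8 * B := by
    rw [hS3, ← Finset.sum_filter]
    refine (Finset.sum_le_card_nsmul _ _ B ?_).trans ?_
    · intro χ hχ
      obtain ⟨-, h1, h2, h3⟩ := Finset.mem_filter.1 hχ
      exact hquad p k hp hk χ h1 h2 h3
    · rw [nsmul_eq_mul]
      apply mul_le_mul_of_nonneg_right _ hB.le
      have h10 := quad_count p k hp hk (Finset.univ.filter
        (fun χ : DirichletCharacter ℂ (p ^ k) => χ ≠ 1 ∧ χ.Even ∧ χ ^ 2 = 1))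
        (fun χ hχ => (Finset.mem_filter.1 hχ).2.2.2)
      exact_mod_cast h10
  have hlp : Real.log 2 ≤ Real.log p :=
    Real.log_le_log (by norm_num) (by exact_mod_cast hp.two_le)
  have hlp0 : 0 < Real.log p := hl2.trans_le hlp
  have hk1 : (1 : ℝ) ≤ k := by exact_mod_cast hk
  have hS2le : S2 ≤ 1 / c ^ 2 * k ^ 3 * (Real.log p) ^ 2 := by
    rw [hS2, ← Finset.sum_filter]
    have hterm : ∀ χ ∈ Finset.univ.filter (fun χ : DirichletCharacter ℂ (p ^ k) =>
        χ ≠ 1 ∧ χ.Even ∧ χ ^ 2 ≠ 1),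
        F χ ≤ 1 / (χ.conductor : ℝ) * ((k * Real.log p) ^ 2 / c ^ 2) := by
      intro χ hχ
      obtain ⟨-, h1, h2, h3⟩ := Finset.mem_filter.1 hχ
      have h4 := hlow (p ^ k) χ h3
      push_cast at h4
      rw [Real.log_pow] at h4
      have hf1 : (1 : ℝ) ≤ χ.conductor := by
        exact_mod_cast Nat.one_le_iff_ne_zero.2 (conductor_ne_zero χ)
      have h5 : 0 < c / (k * Real.log p) := by positivity
      have h6 := pow_le_pow_left₀ h5.le h4 2
      calc F χ = 1 / (χ.conductor : ℝ) * (1 / ‖χ.LFunction 1‖ ^ 2) := by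
            rw [hF]; simp only [one_div, mul_inv]
        _ ≤ 1 / (χ.conductor : ℝ) * (1 / (c / (k * Real.log p)) ^ 2) := by
            apply mul_le_mul_of_nonneg_left _ (by positivity)
            exact one_div_le_one_div_of_le (by positivity) h6
        _ = _ := by rw [div_pow, one_div_div]
    refine (Finset.sum_le_sum hterm).trans ?_
    rw [← Finset.sum_mul]
    have h7 := sum_inv_conductor p k hp (Finset.univ.filter
      (fun χ : DirichletCharacter ℂ (p ^ k) => χ ≠ 1 ∧ χ.Even ∧ χ ^ 2 ≠ 1))
      (fun χ hχ => (Finset.mem_filter.1 hχ).2.1)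
    refine (mul_le_mul_of_nonneg_right h7 (by positivity)).trans (le_of_eq ?_)
    field_simp
  have hX : 0 < 8 * B / (Real.log 2) ^ 2 := by positivity
  have hY : 0 < 1 / c ^ 2 := by positivity
  refine ⟨?_, ?_⟩
  · rw [hdec, add_sub_cancel_left, abs_of_nonneg hS3nn]
    linarith
  · rw [hdec]
    have h8 : 8 * B ≤ 8 * B / (Real.log 2) ^ 2 * k ^ 3 * (Real.log p) ^ 2 := by
      have h9 : (Real.log 2) ^ 2 ≤ (Real.log p) ^ 2 := pow_le_pow_left₀ hl2.le hlp 2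
      have h10 : (1 : ℝ) ≤ (k : ℝ) ^ 3 := one_le_pow₀ hk1
      calc 8 * B = 8 * B / (Real.log 2) ^ 2 * 1 * (Real.log 2) ^ 2 := by field_simp
        _ ≤ _ := by gcongr
    have h11 : 0 ≤ 8 * B * k ^ 3 * (Real.log p) ^ 2 := by positivity
    linarith
end
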